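/- arXiv:1005.1507 — 4 statements merged into one kernel-verified Lean document; each statement's English description precedes it below -/
import Mathlib

section
/- Let λ ∈ (0,1), let c_λ = ( ∫_ℝ (1 − cos s)/|s|^{1+λ} ds )^{−1}, let c ∈ ℝ and b ≥ 0, let u₀: ℝ → ℂ be a Schwartz function with Fourier transform û₀(ξ) = ∫_ℝ e^{−ixξ} u₀(x) dx, and define u(x,t) = (1/(2π)) ∫_ℝ e^{ixξ} û₀(ξ) e^{−(icξ + ξ² + b|ξ|^λ)t} dξ for (x,t) ∈ ℝ × [0,∞). Then: (a) u(·,0) = u₀; (b) for every t > 0 and x ∈ ℝ the partial derivatives ∂_t u, ∂_x u and ∂_x² u exist, the integral defining L[u(·,t)](x) converges absolutely, and ∂_t u(x,t) + c ∂_x u(x,t) = ∂_x² u(x,t) + b L[u(·,t)](x); (c) for every integer k ≥ 0 and every t ≥ 0, ∫_ℝ (1+ξ²)^{k+1} |û₀(ξ) e^{−(icξ + ξ² + b|ξ|^λ)t}|² dξ ≤ ∫_ℝ (1+ξ²)^{k+1} |û₀(ξ)|² dξ. -/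
open MeasureTheory Filter Set

/-- The fractional Laplacian of a complex-valued function on ℝ. -/
noncomputable def fracLapC (clam lam : ℝ) (φ : ℝ → ℂ) (x : ℝ) : ℂ :=
  (clam : ℂ) * ∫ z in ({0}ᶜ : Set ℝ), (φ (x + z) - φ x) / ((|z| ^ (1 + lam) : ℝ) : ℂ)

/-- Absolute convergence of the integral defining the fractional Laplacian at `x`. -/
def fracLapCConv (lam : ℝ) (φ : ℝ → ℂ) (x : ℝ) : Prop :=
  IntegrableOn (fun z : ℝ => (φ (x + z) - φ x) / ((|z| ^ (1 + lam) : ℝ) : ℂ)) ({0}ᶜ : Set ℝ)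

/-- The Fourier transform `û₀(ξ) = ∫ e^{−ixξ} u₀(x) dx`. -/
noncomputable def fourierT (u₀ : ℝ → ℂ) (ξ : ℝ) : ℂ :=
  ∫ x : ℝ, Complex.exp (-Complex.I * x * ξ) * u₀ x

/-- The Fourier multiplier `e^{−(icξ + ξ² + b|ξ|^λ)t}` of the linear equation. -/
noncomputable def linSymb (lam c b : ℝ) (ξ t : ℝ) : ℂ :=
  Complex.exp (-(Complex.I * c * ξ + (ξ : ℂ) ^ 2 + (b : ℂ) * ((|ξ| ^ lam : ℝ) : ℂ)) * t)

/-- The Fourier-synthesis solution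
`u(x,t) = (1/(2π)) ∫ e^{ixξ} û₀(ξ) e^{−(icξ + ξ² + b|ξ|^λ)t} dξ`. -/
noncomputable def uSol (lam c b : ℝ) (u₀ : ℝ → ℂ) (x t : ℝ) : ℂ :=
  (1 / (2 * (Real.pi : ℂ))) *
    ∫ ξ : ℝ, Complex.exp (Complex.I * x * ξ) * fourierT u₀ ξ * linSymb lam c b ξ t

lemma kernel_integrable (lam : ℝ) (h0 : 0 < lam) (h1 : lam < 1) :
    Integrable (fun z : ℝ => min 1 |z| / |z| ^ (1 + lam)) := by
  have := (integrable_fun_norm_addHaar (volume : Measure ℝ)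
    (f := fun y : ℝ => min 1 y / y ^ (1 + lam))).2 ?_
  · simpa [Real.norm_eq_abs] using this
  · simp only [Module.finrank_self, Nat.sub_self, pow_zero, one_smul]
    rw [← Ioc_union_Ioi_eq_Ioi (zero_le_one (α := ℝ))]
    refine IntegrableOn.union ?_ ?_
    · have h := (intervalIntegral.intervalIntegrable_rpow' (a := 0) (b := 1) (r := -lam)
        (by linarith))
      rw [intervalIntegrable_iff_integrableOn_Ioc_of_le zero_le_one] at h
      refine h.congr_fun ?_ measurableSet_Ioc
      intro y hy
      simp only
      rw [min_eq_right hy.2, Real.rpow_add hy.1, Real.rpow_one, Real.rpow_neg hy.1.le]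
      have := hy.1.ne'
      field_simp
    · have h := integrableOn_Ioi_rpow_of_lt (a := -(1 + lam)) (c := 1) (by linarith) one_pos
      refine h.congr_fun ?_ measurableSet_Ioi
      intro y hy
      simp only
      rw [min_eq_left (le_of_lt hy), Real.rpow_neg (zero_le_one.trans (le_of_lt hy)), one_div]

lemma norm_exp_I_sub_one_le (z ξ : ℝ) :
    ‖Complex.exp (Complex.I * z * ξ) - 1‖ ≤ min 1 |z| * (2 * (1 + |ξ|)) := by
  have e : Complex.I * z * ξ = Complex.I * ((z * ξ : ℝ) : ℂ) := by push_cast; ring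
  rw [e]
  have hA := Real.norm_exp_I_mul_ofReal_sub_one_le (x := z * ξ)
  have hB : ‖Complex.exp (Complex.I * ((z * ξ : ℝ) : ℂ)) - 1‖ ≤ 2 := by
    refine (norm_sub_le _ _).trans ?_
    rw [Complex.norm_exp_I_mul_ofReal]; norm_num
  rw [Real.norm_eq_abs, abs_mul] at hA
  have := abs_nonneg z
  have := abs_nonneg ξ
  rcases le_total 1 |z| with h | h
  · rw [min_eq_left h]; nlinarith
  · rw [min_eq_right h]; nlinarith

lemma kernel_bound (lam z ξ : ℝ) :
    ‖(Complex.exp (Complex.I * z * ξ) - 1) / ((|z| ^ (1 + lam) : ℝ) : ℂ)‖ ≤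
      (min 1 |z| / |z| ^ (1 + lam)) * (2 * (1 + |ξ|)) := by
  have hp : 0 ≤ |z| ^ (1 + lam) := by positivity
  rw [norm_div, Complex.norm_real, Real.norm_of_nonneg hp, div_mul_eq_mul_div]
  exact div_le_div_of_nonneg_right (norm_exp_I_sub_one_le z ξ) hp

lemma kernel_exp_integrable (lam : ℝ) (h0 : 0 < lam) (h1 : lam < 1) (ξ : ℝ) :
    Integrable (fun z : ℝ =>
      (Complex.exp (Complex.I * z * ξ) - 1) / ((|z| ^ (1 + lam) : ℝ) : ℂ)) := by
  refine ((kernel_integrable lam h0 h1).mul_const (2 * (1 + |ξ|))).mono' ?_ ?_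
  · exact Measurable.aestronglyMeasurable (by fun_prop)
  · exact Eventually.of_forall fun z => kernel_bound lam z ξ

lemma cos_kernel_integrable (lam : ℝ) (h0 : 0 < lam) (h1 : lam < 1) :
    Integrable (fun s : ℝ => (1 - Real.cos s) / |s| ^ (1 + lam)) := by
  refine ((kernel_exp_integrable lam h0 h1 1).norm).mono' ?_ ?_
  · exact Measurable.aestronglyMeasurable (by fun_prop)
  · refine Eventually.of_forall fun z => ?_
    have hp : 0 ≤ |z| ^ (1 + lam) := by positivity
    rw [norm_div, norm_div, Complex.norm_real]
    refine div_le_div_of_nonneg_right ?_ (norm_nonneg _)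
    rw [← norm_neg (Complex.exp _ - 1)]
    refine le_trans (le_of_eq ?_) (Complex.abs_re_le_norm _)
    simp [Complex.exp_re]

lemma cos_kernel_pos (lam : ℝ) (h0 : 0 < lam) (h1 : lam < 1) :
    0 < ∫ s : ℝ, (1 - Real.cos s) / |s| ^ (1 + lam) := by
  rw [integral_pos_iff_support_of_nonneg _ (cos_kernel_integrable lam h0 h1)]
  · refine lt_of_lt_of_le (b := volume (Ioo (0 : ℝ) 1)) (by simp) (measure_mono ?_)
    intro s hs
    have hc : Real.cos s < 1 := by
      have := Real.cos_lt_cos_of_nonneg_of_le_pi_div_two le_rfl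
        (by linarith [Real.pi_gt_three, hs.2] : s ≤ Real.pi / 2) hs.1
      simpa using this
    have : 0 < |s| := abs_pos.2 hs.1.ne'
    have : 0 < |s| ^ (1 + lam) := by positivity
    rw [Function.mem_support]
    exact (div_pos (by linarith) this).ne'
  · intro s
    exact div_nonneg (by linarith [Real.cos_le_one s]) (by positivity)

lemma kernel_exp_integral_one (lam : ℝ) (h0 : 0 < lam) (h1 : lam < 1) :
    ∫ z : ℝ, (Complex.exp (Complex.I * z) - 1) / ((|z| ^ (1 + lam) : ℝ) : ℂ) =
      -((∫ s : ℝ, (1 - Real.cos s) / |s| ^ (1 + lam) : ℝ) : ℂ) := by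
  have hi := kernel_exp_integrable lam h0 h1 1
  simp only [Complex.ofReal_one, mul_one] at hi
  have hi2 := hi.comp_neg
  have e := integral_neg_eq_self (fun z : ℝ => (Complex.exp (Complex.I * z) - 1) / ((|z| ^ (1 + lam) : ℝ) : ℂ)) volume
  have s := integral_add hi hi2
  rw [e] at s
  have k : ∫ z : ℝ, ((Complex.exp (Complex.I * z) - 1) / ((|z| ^ (1 + lam) : ℝ) : ℂ) +
      (Complex.exp (Complex.I * ((-z : ℝ) : ℂ)) - 1) / ((|(-z)| ^ (1 + lam) : ℝ) : ℂ)) =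
      -2 * ((∫ s : ℝ, (1 - Real.cos s) / |s| ^ (1 + lam) : ℝ) : ℂ) := by
    rw [← integral_complex_ofReal, ← integral_const_mul]
    congr 1
    ext z
    rw [abs_neg, ← add_div]
    push_cast
    rw [← mul_div_assoc]
    congr 1
    rw [Complex.cos]
    rw [show Complex.I * -(z : ℂ) = -z * Complex.I by ring, show Complex.I * (z : ℂ) = z * Complex.I by ring]
    ring
  rw [k] at s
  linear_combination (-1 / 2) * s

lemma kernel_exp_integral (lam : ℝ) (h0 : 0 < lam) (h1 : lam < 1) (ξ : ℝ) :
    ∫ z : ℝ, (Complex.exp (Complex.I * z * ξ) - 1) / ((|z| ^ (1 + lam) : ℝ) : ℂ) =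
      -((|ξ| ^ lam : ℝ) : ℂ) * ((∫ s : ℝ, (1 - Real.cos s) / |s| ^ (1 + lam) : ℝ) : ℂ) := by
  rcases eq_or_ne ξ 0 with rfl | hξ
  · simp [Real.zero_rpow h0.ne']
  have hpos : 0 < |ξ| := abs_pos.2 hξ
  have h := Measure.integral_comp_mul_left (fun z : ℝ => (Complex.exp (Complex.I * z) - 1) /
    ((|z| ^ (1 + lam) : ℝ) : ℂ)) ξ
  rw [kernel_exp_integral_one lam h0 h1] at h
  have k : ∀ z : ℝ, (Complex.exp (Complex.I * z * ξ) - 1) / ((|z| ^ (1 + lam) : ℝ) : ℂ) =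
      ((|ξ| ^ (1 + lam) : ℝ) : ℂ) * ((Complex.exp (Complex.I * ((ξ * z : ℝ) : ℂ)) - 1) /
        ((|ξ * z| ^ (1 + lam) : ℝ) : ℂ)) := by
    intro z
    rw [abs_mul, Real.mul_rpow (abs_nonneg _) (abs_nonneg _)]
    have : ((|ξ| ^ (1 + lam) : ℝ) : ℂ) ≠ 0 := by
      exact_mod_cast (Real.rpow_pos_of_pos hpos _).ne'
    rw [show Complex.I * z * ξ = Complex.I * ((ξ * z : ℝ) : ℂ) by push_cast; ring]
    rw [Complex.ofReal_mul (|ξ| ^ (1 + lam)), mul_div_assoc', mul_div_mul_left _ _ this]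
  simp_rw [k]
  rw [integral_const_mul, h, Real.rpow_add hpos, Real.rpow_one, abs_inv, Complex.real_smul]
  have : ((|ξ| : ℝ) : ℂ) ≠ 0 := by exact_mod_cast hpos.ne'
  push_cast
  field_simp

lemma norm_exp_I_mul_mul (x ξ : ℝ) : ‖Complex.exp (Complex.I * x * ξ)‖ = 1 := by
  rw [show Complex.I * x * ξ = Complex.I * ((x * ξ : ℝ) : ℂ) by push_cast; ring]
  exact Complex.norm_exp_I_mul_ofReal _

lemma exp_mul_integrable (g : ℝ → ℂ) (hg : Integrable g) (x : ℝ) :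
    Integrable (fun ξ : ℝ => Complex.exp (Complex.I * x * ξ) * g ξ) := by
  refine hg.norm.mono' ?_ ?_
  · exact (Continuous.aestronglyMeasurable (by fun_prop)).mul hg.1
  · exact Eventually.of_forall fun ξ => by rw [norm_mul, norm_exp_I_mul_mul, one_mul]

lemma synth_hasDerivAt (g : ℝ → ℂ) (hg : Integrable g)
    (hg1 : Integrable (fun ξ : ℝ => Complex.I * ξ * g ξ)) (x : ℝ) :
    HasDerivAt (fun y : ℝ => ∫ ξ : ℝ, Complex.exp (Complex.I * y * ξ) * g ξ)
      (∫ ξ : ℝ, Complex.exp (Complex.I * x * ξ) * (Complex.I * ξ * g ξ)) x := by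
  refine (hasDerivAt_integral_of_dominated_loc_of_deriv_le (s := univ)
    (F := fun (y : ℝ) (ξ : ℝ) => Complex.exp (Complex.I * y * ξ) * g ξ)
    (F' := fun (y : ℝ) (ξ : ℝ) => Complex.exp (Complex.I * y * ξ) * (Complex.I * ξ * g ξ))
    (bound := fun ξ : ℝ => ‖Complex.I * ξ * g ξ‖)
    univ_mem ?_ (exp_mul_integrable g hg x) (exp_mul_integrable _ hg1 x).1 ?_ hg1.norm ?_).2
  · exact Eventually.of_forall fun y => (exp_mul_integrable g hg y).1
  · exact Eventually.of_forall fun ξ y _ => by rw [norm_mul, norm_exp_I_mul_mul, one_mul]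
  · refine Eventually.of_forall fun ξ y _ => ?_
    have h1 : HasDerivAt (fun y : ℝ => Complex.I * (y : ℂ) * ξ) (Complex.I * 1 * ξ) y :=
      ((Complex.ofRealCLM.hasDerivAt (x := y)).const_mul Complex.I).mul_const _
    refine ((h1.cexp).mul_const (g ξ)).congr_deriv ?_
    ring

lemma fracLap_synth (lam clam : ℝ) (h0 : 0 < lam) (h1 : lam < 1)
    (hclam : clam = (∫ s : ℝ, (1 - Real.cos s) / |s| ^ (1 + lam))⁻¹)
    (A : ℂ) (g : ℝ → ℂ) (hg : Integrable g)
    (hg1 : Integrable (fun ξ : ℝ => Complex.I * ξ * g ξ)) (x : ℝ) :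
    fracLapCConv lam (fun y => A * ∫ ξ : ℝ, Complex.exp (Complex.I * y * ξ) * g ξ) x ∧
    fracLapC clam lam (fun y => A * ∫ ξ : ℝ, Complex.exp (Complex.I * y * ξ) * g ξ) x =
      A * ∫ ξ : ℝ, Complex.exp (Complex.I * x * ξ) * (-((|ξ| ^ lam : ℝ) : ℂ) * g ξ) := by
  set K : ℝ → ℝ → ℂ := fun z ξ =>
    (Complex.exp (Complex.I * z * ξ) - 1) / ((|z| ^ (1 + lam) : ℝ) : ℂ) *
      (Complex.exp (Complex.I * x * ξ) * g ξ) with hK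
  have hKi : Integrable (Function.uncurry K) (volume.prod volume) := by
    have hgb : Integrable (fun ξ : ℝ => 2 * (‖g ξ‖ + ‖Complex.I * ξ * g ξ‖)) :=
      (hg.norm.add hg1.norm).const_mul 2
    refine ((kernel_integrable lam h0 h1).mul_prod hgb).mono' ?_ ?_
    · refine AEStronglyMeasurable.mul ?_ ?_
      · exact Measurable.aestronglyMeasurable (by fun_prop)
      · exact (exp_mul_integrable g hg x).1.comp_snd
    · refine Eventually.of_forall fun p => ?_
      simp only [Function.uncurry, hK]
      rw [norm_mul, norm_mul (Complex.exp _), norm_exp_I_mul_mul, one_mul]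
      refine (mul_le_mul_of_nonneg_right (kernel_bound lam p.1 p.2) (norm_nonneg _)).trans
        (le_of_eq ?_)
      simp only [norm_mul, Complex.norm_I, Complex.norm_real, Real.norm_eq_abs]
      ring
  have hdiff : ∀ z : ℝ, ((A * ∫ ξ : ℝ, Complex.exp (Complex.I * ((x + z : ℝ) : ℂ) * ξ) * g ξ) -
      A * ∫ ξ : ℝ, Complex.exp (Complex.I * x * ξ) * g ξ) / ((|z| ^ (1 + lam) : ℝ) : ℂ) =
      A * ∫ ξ, K z ξ := by
    intro z
    rw [← mul_sub, ← integral_sub (exp_mul_integrable g hg _) (exp_mul_integrable g hg _),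
      mul_div_assoc, ← integral_div]
    congr 2
    ext ξ
    simp only [hK]
    rw [show Complex.I * ((x + z : ℝ) : ℂ) * ξ = Complex.I * z * ξ + Complex.I * x * ξ by
      push_cast; ring, Complex.exp_add]
    ring
  constructor
  · unfold fracLapCConv
    rw [IntegrableOn, restrict_compl_singleton]
    simp_rw [hdiff]
    exact hKi.integral_prod_left.const_mul A
  · unfold fracLapC
    rw [restrict_compl_singleton]
    simp_rw [hdiff]
    rw [integral_const_mul, integral_integral_swap hKi]
    simp only [hK]
    simp_rw [integral_mul_const, kernel_exp_integral lam h0 h1]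
    have hD : ((∫ s : ℝ, (1 - Real.cos s) / |s| ^ (1 + lam) : ℝ) : ℂ) ≠ 0 := by
      exact_mod_cast (cos_kernel_pos lam h0 h1).ne'
    rw [mul_left_comm, ← integral_const_mul, hclam]
    congr 2
    ext ξ
    rw [Complex.ofReal_inv]
    generalize ((∫ s : ℝ, (1 - Real.cos s) / |s| ^ (1 + lam) : ℝ) : ℂ) = D at *
    field_simp

open FourierTransform in
lemma fourierT_eq (u₀ : SchwartzMap ℝ ℂ) (ξ : ℝ) :
    fourierT (fun y => u₀ y) ξ = (𝓕 u₀) ((2 * Real.pi)⁻¹ * ξ) := by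
  rw [SchwartzMap.fourier_coe, Real.fourier_real_eq_integral_exp_smul, fourierT]
  congr 1
  ext v
  rw [smul_eq_mul]
  congr 2
  have : (Real.pi : ℂ) ≠ 0 := by exact_mod_cast Real.pi_ne_zero
  push_cast
  field_simp

open FourierTransform in
lemma exists_schwartz (u₀ : SchwartzMap ℝ ℂ) :
    ∃ G : SchwartzMap ℝ ℂ, ∀ ξ, fourierT (fun y => u₀ y) ξ = G ξ := by
  have h : (2 * Real.pi)⁻¹ ≠ 0 := by positivity
  refine ⟨SchwartzMap.compCLMOfContinuousLinearEquiv ℂ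
    (ContinuousLinearEquiv.unitsEquivAut ℝ (Units.mk0 _ h)) (𝓕 u₀), fun ξ => ?_⟩
  rw [fourierT_eq]
  simp [mul_comm]

open FourierTransform in
lemma uSol_zero (lam c b : ℝ) (u₀ : SchwartzMap ℝ ℂ) (x : ℝ) :
    uSol lam c b (fun y => u₀ y) x 0 = u₀ x := by
  have hp : (Real.pi : ℂ) ≠ 0 := by exact_mod_cast Real.pi_ne_zero
  have e : u₀ x = (𝓕⁻ (𝓕 u₀)) x := by simp
  rw [e, SchwartzMap.fourierInv_coe, Real.fourierInv_eq', uSol]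
  have h := Measure.integral_comp_mul_left (fun v : ℝ =>
    Complex.exp ((2 * Real.pi * inner ℝ v x : ℝ) * Complex.I) • (𝓕 u₀) v) ((2 * Real.pi)⁻¹)
  have hc : ∫ ξ : ℝ, Complex.exp (Complex.I * x * ξ) * fourierT (fun y => u₀ y) ξ *
      linSymb lam c b ξ 0 = ∫ ξ : ℝ, Complex.exp ((2 * Real.pi * inner ℝ ((2 * Real.pi)⁻¹ * ξ) x : ℝ)
        * Complex.I) • (𝓕 u₀) ((2 * Real.pi)⁻¹ * ξ) := by
    congr 1
    ext ξ
    rw [fourierT_eq, smul_eq_mul, linSymb]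
    simp only [Complex.ofReal_zero, mul_zero, Complex.exp_zero, mul_one]
    congr 2
    simp
    field_simp
  rw [hc, h, inv_inv, abs_of_pos (by positivity), Complex.real_smul]
  push_cast
  field_simp
  congr 1
  ext v
  congr 2
  ring

lemma linSymb_eq (lam c b ξ t : ℝ) : linSymb lam c b ξ t =
    Complex.exp (-(Complex.I * c * ξ + (ξ : ℂ) ^ 2 + (b : ℂ) * ((|ξ| ^ lam : ℝ) : ℂ)) * t) := rfl

lemma linSymb_norm_le (lam c b : ℝ) (hb : 0 ≤ b) (ξ t : ℝ) (ht : 0 ≤ t) :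
    ‖linSymb lam c b ξ t‖ ≤ 1 := by
  rw [linSymb, Complex.norm_exp]
  have : (-(Complex.I * c * ξ + (ξ : ℂ) ^ 2 + (b : ℂ) * ((|ξ| ^ lam : ℝ) : ℂ)) * t).re
      = -((ξ ^ 2 + b * |ξ| ^ lam) * t) := by
    rw [← Complex.ofReal_pow, ← Complex.ofReal_mul]
    simp [-Complex.ofReal_pow, -Complex.ofReal_mul]
    ring
  rw [this, Real.exp_le_one_iff, neg_nonpos]
  positivity

lemma linSymb_measurable (lam c b t : ℝ) : Measurable (fun ξ => linSymb lam c b ξ t) := by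
  unfold linSymb
  fun_prop

lemma schwartz_mul_symb_integrable (G : SchwartzMap ℝ ℂ) (lam c b : ℝ) (hb : 0 ≤ b)
    (t : ℝ) (ht : 0 ≤ t) (k : ℕ) (a : ℝ → ℂ) (ha : Measurable a) (C : ℝ)
    (hab : ∀ ξ, ‖a ξ‖ ≤ C * (1 + |ξ| ^ k)) :
    Integrable (fun ξ => a ξ * (G ξ * linSymb lam c b ξ t)) := by
  have h0 := SchwartzMap.integrable_pow_mul (volume : Measure ℝ) G 0
  have h1 := SchwartzMap.integrable_pow_mul (volume : Measure ℝ) G k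
  refine ((h0.add h1).const_mul C).mono' ?_ ?_
  · exact (ha.mul (G.continuous.measurable.mul (linSymb_measurable lam c b t))).aestronglyMeasurable
  · refine Eventually.of_forall fun ξ => ?_
    have := linSymb_norm_le lam c b hb ξ t ht
    rw [norm_mul, norm_mul]
    calc ‖a ξ‖ * (‖G ξ‖ * ‖linSymb lam c b ξ t‖) ≤ C * (1 + |ξ| ^ k) * (‖G ξ‖ * 1) := by
          have := (norm_nonneg (a ξ)).trans (hab ξ)
          gcongr
          exact hab ξ
      _ = _ := by simp [Real.norm_eq_abs]; ring

lemma rpow_le_aux (lam ξ : ℝ) (h0 : 0 < lam) (h1 : lam < 1) : |ξ| ^ lam ≤ 1 + |ξ| ^ 2 := by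
  have := abs_nonneg ξ
  rcases le_total |ξ| 1 with h | h
  · have := Real.rpow_le_one this h h0.le
    nlinarith [sq_nonneg |ξ|]
  · have := Real.rpow_le_rpow_of_exponent_le h h1.le
    rw [Real.rpow_one] at this
    nlinarith

lemma symbol_bound (lam c b : ℝ) (h0 : 0 < lam) (h1 : lam < 1) (hb : 0 ≤ b) (ξ : ℝ) :
    ‖-(Complex.I * c * ξ + (ξ : ℂ) ^ 2 + (b : ℂ) * ((|ξ| ^ lam : ℝ) : ℂ))‖ ≤
      (|c| + 1 + b) * (1 + |ξ| ^ 2) := by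
  rw [norm_neg]
  refine (norm_add₃_le).trans ?_
  have hp : 0 ≤ |ξ| ^ lam := by positivity
  simp only [norm_mul, Complex.norm_I, Complex.norm_real, Real.norm_eq_abs, norm_pow,
    abs_of_nonneg hb, abs_of_nonneg hp, one_mul]
  have e1 : |c| * |ξ| ≤ |c| * (1 + |ξ| ^ 2) :=
    mul_le_mul_of_nonneg_left (by nlinarith [sq_nonneg (|ξ| - 1), abs_nonneg ξ]) (abs_nonneg c)
  have e2 := mul_le_mul_of_nonneg_left (rpow_le_aux lam ξ h0 h1) hb
  nlinarith

lemma synth_time_deriv (G : SchwartzMap ℝ ℂ) (lam c b : ℝ) (h0 : 0 < lam) (h1 : lam < 1)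
    (hb : 0 ≤ b) (t : ℝ) (ht : 0 < t) (x : ℝ) :
    HasDerivAt (fun s : ℝ => ∫ ξ : ℝ, Complex.exp (Complex.I * x * ξ) *
        (G ξ * linSymb lam c b ξ s))
      (∫ ξ : ℝ, Complex.exp (Complex.I * x * ξ) *
        (-(Complex.I * c * ξ + (ξ : ℂ) ^ 2 + (b : ℂ) * ((|ξ| ^ lam : ℝ) : ℂ)) *
          (G ξ * linSymb lam c b ξ t))) t := by
  have hi : ∀ s : ℝ, 0 ≤ s → Integrable (fun ξ => G ξ * linSymb lam c b ξ s) := by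
    intro s hs
    simpa using schwartz_mul_symb_integrable G lam c b hb s hs 0 (fun _ => 1)
      measurable_const 1 (by intro ξ; simp)
  have hi2 := fun (s : ℝ) (hs : 0 ≤ s) => schwartz_mul_symb_integrable G lam c b hb s hs 2
    (fun ξ : ℝ => -(Complex.I * c * ξ + (ξ : ℂ) ^ 2 + (b : ℂ) * ((|ξ| ^ lam : ℝ) : ℂ)))
    (by fun_prop) _ (symbol_bound lam c b h0 h1 hb)
  have hb0 := hi2 0 le_rfl
  refine (hasDerivAt_integral_of_dominated_loc_of_deriv_le (s := Ioi 0)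
    (F := fun (s : ℝ) (ξ : ℝ) => Complex.exp (Complex.I * x * ξ) * (G ξ * linSymb lam c b ξ s))
    (F' := fun (s : ℝ) (ξ : ℝ) => Complex.exp (Complex.I * x * ξ) *
        (-(Complex.I * c * ξ + (ξ : ℂ) ^ 2 + (b : ℂ) * ((|ξ| ^ lam : ℝ) : ℂ)) *
          (G ξ * linSymb lam c b ξ s)))
    (Ioi_mem_nhds ht) ?_ (exp_mul_integrable _ (hi t ht.le) x)
    (exp_mul_integrable _ (hi2 t ht.le) x).1 ?_ hb0.norm ?_).2
  · filter_upwards [Ioi_mem_nhds ht] with s hs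
    exact (exp_mul_integrable _ (hi s (le_of_lt hs)) x).1
  · refine Eventually.of_forall fun ξ s hs => ?_
    have := linSymb_norm_le lam c b hb ξ s (le_of_lt hs)
    have e0 : linSymb lam c b ξ 0 = 1 := by simp [linSymb]
    rw [norm_mul, norm_exp_I_mul_mul, one_mul, e0, mul_one, norm_mul, norm_mul, norm_mul]
    gcongr
    exact mul_le_of_le_one_right (norm_nonneg _) this
  · refine Eventually.of_forall fun ξ s _ => ?_
    simp only [linSymb_eq]
    generalize -(Complex.I * c * ξ + (ξ : ℂ) ^ 2 + (b : ℂ) * ((|ξ| ^ lam : ℝ) : ℂ)) = m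
    have h1 : HasDerivAt (fun s : ℝ => m * (s : ℂ)) (m * 1) s :=
      (Complex.ofRealCLM.hasDerivAt (x := s)).const_mul m
    refine (((h1.cexp).const_mul (G ξ)).const_mul (Complex.exp (Complex.I * x * ξ))).congr_deriv ?_
    ring

lemma energy_le (G : SchwartzMap ℝ ℂ) (lam c b : ℝ) (hb : 0 ≤ b) (k : ℕ) (t : ℝ) (ht : 0 ≤ t) :
    ∫ ξ : ℝ, (1 + ξ ^ 2) ^ (k + 1) * ‖G ξ * linSymb lam c b ξ t‖ ^ 2 ≤
        ∫ ξ : ℝ, (1 + ξ ^ 2) ^ (k + 1) * ‖G ξ‖ ^ 2 := by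
  refine integral_mono_of_nonneg ?_ ?_ ?_
  · exact Eventually.of_forall fun ξ => by positivity
  · obtain ⟨C, hC⟩ : ∃ C, ∀ ξ, ‖G ξ‖ ≤ C := by
      obtain ⟨C, _, hC⟩ := G.decay 0 0
      exact ⟨C, by simpa using hC⟩
    have h0 := SchwartzMap.integrable_pow_mul (volume : Measure ℝ) G 0
    have h1 := SchwartzMap.integrable_pow_mul (volume : Measure ℝ) G (2 * (k + 1))
    refine (((h0.add h1).const_mul (2 ^ k)).mul_const C).mono' ?_ ?_
    · have := G.continuous
      exact Continuous.aestronglyMeasurable (by fun_prop)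
    · refine Eventually.of_forall fun ξ => ?_
      rw [Real.norm_of_nonneg (by positivity)]
      have h := add_pow_le (zero_le_one (α := ℝ)) (sq_nonneg ξ) (k + 1)
      have e : (1 + ξ ^ 2) ^ (k + 1) ≤ 2 ^ k * (1 + |ξ| ^ (2 * (k + 1))) := by
        simpa [pow_mul, sq_abs] using h
      calc (1 + ξ ^ 2) ^ (k + 1) * ‖G ξ‖ ^ 2
          = (1 + ξ ^ 2) ^ (k + 1) * ‖G ξ‖ * ‖G ξ‖ := by ring
        _ ≤ 2 ^ k * (1 + |ξ| ^ (2 * (k + 1))) * ‖G ξ‖ * C := by gcongr; exact hC ξ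
        _ = _ := by simp only [Pi.add_apply, Real.norm_eq_abs, pow_zero]; ring
  · refine Eventually.of_forall fun ξ => ?_
    have := linSymb_norm_le lam c b hb ξ t ht
    simp only
    gcongr
    rw [norm_mul]
    exact mul_le_of_le_one_right (norm_nonneg _) this

/-- For Schwartz initial data, the Fourier-synthesis formula solves the linear fractional
convection–diffusion equation: (a) the initial datum is attained; (b) for `t > 0` all the
relevant derivatives exist, the fractional Laplacian converges absolutely, and the PDE
`∂_t u + c ∂_x u = ∂_x² u + b L[u]` holds pointwise; (c) the weighted Fourier energies
are nonincreasing in time. -/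
theorem linear_fourier_solution (lam : ℝ) (hlam : lam ∈ Set.Ioo (0 : ℝ) 1)
    (clam : ℝ) (hclam : clam = (∫ s : ℝ, (1 - Real.cos s) / |s| ^ (1 + lam))⁻¹)
    (c b : ℝ) (hb : 0 ≤ b) (u₀ : SchwartzMap ℝ ℂ) :
    (∀ x : ℝ, uSol lam c b (fun y => u₀ y) x 0 = u₀ x) ∧
    (∃ ut ux uxx : ℝ → ℝ → ℂ,
      ∀ t : ℝ, 0 < t → ∀ x : ℝ,
        HasDerivAt (fun s => uSol lam c b (fun y => u₀ y) x s) (ut x t) t ∧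
        HasDerivAt (fun y => uSol lam c b (fun y' => u₀ y') y t) (ux x t) x ∧
        HasDerivAt (fun y => ux y t) (uxx x t) x ∧
        fracLapCConv lam (fun y => uSol lam c b (fun y' => u₀ y') y t) x ∧
        ut x t + (c : ℂ) * ux x t =
          uxx x t + (b : ℂ) * fracLapC clam lam (fun y => uSol lam c b (fun y' => u₀ y') y t) x) ∧
    (∀ k : ℕ, ∀ t : ℝ, 0 ≤ t →
      ∫ ξ : ℝ, (1 + ξ ^ 2) ^ (k + 1) * ‖fourierT (fun y => u₀ y) ξ * linSymb lam c b ξ t‖ ^ 2 ≤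
        ∫ ξ : ℝ, (1 + ξ ^ 2) ^ (k + 1) * ‖fourierT (fun y => u₀ y) ξ‖ ^ 2) := by
  obtain ⟨h0, h1⟩ := hlam
  refine ⟨uSol_zero lam c b u₀, ?_, ?_⟩
  · obtain ⟨G, hG⟩ := exists_schwartz u₀
    have hu : ∀ x t, uSol lam c b (fun y => u₀ y) x t = (1 / (2 * (Real.pi : ℂ))) *
        ∫ ξ : ℝ, Complex.exp (Complex.I * x * ξ) * (G ξ * linSymb lam c b ξ t) := by
      intro x t
      simp only [uSol, hG, mul_assoc]
    simp only [hu]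
    set A : ℂ := 1 / (2 * (Real.pi : ℂ))
    refine ⟨fun x t => A * ∫ ξ : ℝ, Complex.exp (Complex.I * x * ξ) *
        (-(Complex.I * c * ξ + (ξ : ℂ) ^ 2 + (b : ℂ) * ((|ξ| ^ lam : ℝ) : ℂ)) *
          (G ξ * linSymb lam c b ξ t)),
      fun x t => A * ∫ ξ : ℝ, Complex.exp (Complex.I * x * ξ) *
        (Complex.I * ξ * (G ξ * linSymb lam c b ξ t)),
      fun x t => A * ∫ ξ : ℝ, Complex.exp (Complex.I * x * ξ) *
        (Complex.I * ξ * (Complex.I * ξ * (G ξ * linSymb lam c b ξ t))), ?_⟩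
    intro t ht x
    have hi : Integrable (fun ξ => G ξ * linSymb lam c b ξ t) := by
      simpa using schwartz_mul_symb_integrable G lam c b hb t ht.le 0 (fun _ => 1)
        measurable_const 1 (by intro ξ; simp)
    have hi1 : Integrable (fun ξ : ℝ => Complex.I * ξ * (G ξ * linSymb lam c b ξ t)) :=
      schwartz_mul_symb_integrable G lam c b hb t ht.le 1 (fun ξ : ℝ => Complex.I * ξ)
        (by fun_prop) 1 (by intro ξ; simp)
    have hi2 : Integrable (fun ξ : ℝ =>
        Complex.I * ξ * (Complex.I * ξ * (G ξ * linSymb lam c b ξ t))) := by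
      have := schwartz_mul_symb_integrable G lam c b hb t ht.le 2
        (fun ξ : ℝ => Complex.I * ξ * (Complex.I * ξ))
        (by fun_prop) 1 (by intro ξ; simp; nlinarith [sq_abs ξ])
      simpa only [mul_assoc] using this
    have hil : Integrable (fun ξ : ℝ =>
        -((|ξ| ^ lam : ℝ) : ℂ) * (G ξ * linSymb lam c b ξ t)) := by
      refine schwartz_mul_symb_integrable G lam c b hb t ht.le 2
        (fun ξ : ℝ => -((|ξ| ^ lam : ℝ) : ℂ)) (by fun_prop) 1 ?_
      intro ξ
      have hp : 0 ≤ |ξ| ^ lam := by positivity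
      rw [norm_neg, Complex.norm_real, Real.norm_of_nonneg hp, one_mul]
      exact rpow_le_aux lam ξ h0 h1
    obtain ⟨hL1, hL2⟩ := fracLap_synth lam clam h0 h1 hclam A _ hi hi1 x
    refine ⟨(synth_time_deriv G lam c b h0 h1 hb t ht x).const_mul A,
      (synth_hasDerivAt _ hi hi1 x).const_mul A, (synth_hasDerivAt _ hi1 hi2 x).const_mul A,
      hL1, ?_⟩
    rw [hL2]
    have E1 := exp_mul_integrable _ hi1 x
    have E2 := exp_mul_integrable _ hi2 x
    have El := exp_mul_integrable _ hil x
    have key : ∫ ξ : ℝ, Complex.exp (Complex.I * x * ξ) *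
        (-(Complex.I * c * ξ + (ξ : ℂ) ^ 2 + (b : ℂ) * ((|ξ| ^ lam : ℝ) : ℂ)) *
          (G ξ * linSymb lam c b ξ t)) =
        (∫ ξ : ℝ, Complex.exp (Complex.I * x * ξ) *
          (Complex.I * ξ * (Complex.I * ξ * (G ξ * linSymb lam c b ξ t)))) +
        (b : ℂ) * (∫ ξ : ℝ, Complex.exp (Complex.I * x * ξ) *
          (-((|ξ| ^ lam : ℝ) : ℂ) * (G ξ * linSymb lam c b ξ t))) -
        (c : ℂ) * (∫ ξ : ℝ, Complex.exp (Complex.I * x * ξ) *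
          (Complex.I * ξ * (G ξ * linSymb lam c b ξ t))) := by
      rw [← integral_const_mul, ← integral_const_mul, ← integral_add E2 (El.const_mul _),
        ← integral_sub (by exact E2.add (El.const_mul _)) (E1.const_mul _)]
      congr 1
      ext ξ
      linear_combination (-Complex.exp (Complex.I * x * ξ) * (ξ : ℂ) ^ 2 *
        (G ξ * linSymb lam c b ξ t)) * Complex.I_sq
    simp only
    rw [key]
    ring
  · obtain ⟨G, hG⟩ := exists_schwartz u₀
    intro k t ht
    simp only [hG]
    exact energy_le G lam c b hb k t ht
end

section
/- Assume u₀ ∈ L¹(ℝ) ∩ BV(ℝ), that f is continuously differentiable, and that the CFL condition holds. Then for every integer n ≥ 0 the double series defining W_i^n converges absolutely for every i and sup_{i∈ℤ} |W_i^n| ≤ sup_{i∈ℤ} |W_i^0|. -/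
open MeasureTheory Filter Set

/-- The fractional Laplacian `L[φ](x) = c_λ ∫_{z ≠ 0} (φ(x+z) − φ(x))/|z|^{1+λ} dz`. -/
noncomputable def fracLap (clam lam : ℝ) (φ : ℝ → ℝ) (x : ℝ) : ℝ :=
  clam * ∫ z in ({0}ᶜ : Set ℝ), (φ (x + z) - φ x) / |z| ^ (1 + lam)

/-- Indicator function of the cell `I_j = (jΔx, (j+1)Δx)`. -/
noncomputable def cellInd (Δx : ℝ) (j : ℤ) : ℝ → ℝ :=
  Set.indicator (Set.Ioo ((j : ℝ) * Δx) (((j : ℝ) + 1) * Δx)) 1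

/-- The weights `G^i_j = ∫_{I_i} L[1_{I_j}](x) dx`. -/
noncomputable def Gw (clam lam Δx : ℝ) (i j : ℤ) : ℝ :=
  ∫ x in Set.Ioo ((i : ℝ) * Δx) (((i : ℝ) + 1) * Δx), fracLap clam lam (cellInd Δx j) x

/-- `A(u) = ∫_0^u a(s) ds`. -/
noncomputable def Aint (a : ℝ → ℝ) (u : ℝ) : ℝ := ∫ s in (0:ℝ)..u, a s

/-- One step of the explicit scheme. -/
noncomputable def schemeStep (clam lam Δx Δt b : ℝ) (fhat : ℝ → ℝ → ℝ) (a : ℝ → ℝ)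
    (U : ℤ → ℝ) (i : ℤ) : ℝ :=
  U i - (Δt / Δx) * (fhat (U i) (U (i + 1)) - fhat (U (i - 1)) (U i))
    + (Δt / Δx ^ 2) * (Aint a (U (i + 1)) - 2 * Aint a (U i) + Aint a (U (i - 1)))
    + (b * Δt / Δx) * ∑' j : ℤ, Gw clam lam Δx i j * U j

/-- The scheme iterates: `U^0_i = (1/Δx)∫_{I_i} u₀` and `U^{n+1} = S(U^n)`. -/
noncomputable def Uiter (clam lam Δx Δt b : ℝ) (fhat : ℝ → ℝ → ℝ) (a : ℝ → ℝ)
    (u₀ : ℝ → ℝ) : ℕ → ℤ → ℝ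
  | 0 => fun i => (1 / Δx) * ∫ x in Set.Ioo ((i : ℝ) * Δx) (((i : ℝ) + 1) * Δx), u₀ x
  | n + 1 => schemeStep clam lam Δx Δt b fhat a (Uiter clam lam Δx Δt b fhat a u₀ n)

/-- `d_λ = c_λ ( ∫_{|z|<1} |z|^{−λ} dz + ∫_{|z|>1} |z|^{−1−λ} dz )`. -/
noncomputable def dlam (clam lam : ℝ) : ℝ :=
  clam * ((∫ z in {z : ℝ | |z| < 1}, |z| ^ (-lam)) + ∫ z in {z : ℝ | 1 < |z|}, |z| ^ (-1 - lam))

/-- The CFL condition: `f̂` is C¹ with bounded partial derivatives and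
`(Δt/Δx)(‖∂₁f̂‖_∞ + ‖∂₂f̂‖_∞) + (2Δt/Δx²)‖a‖_∞ + b d_λ Δt/Δx^λ ≤ 1`. -/
def CFL (clam lam Δx Δt b : ℝ) (fhat : ℝ → ℝ → ℝ) (a : ℝ → ℝ) : Prop :=
  ContDiff ℝ 1 (fun p : ℝ × ℝ => fhat p.1 p.2) ∧
  ∃ M1 M2 Ma : ℝ,
    (∀ u v : ℝ, |deriv (fun s => fhat s v) u| ≤ M1) ∧
    (∀ u v : ℝ, |deriv (fun s => fhat u s) v| ≤ M2) ∧
    (∀ s : ℝ, |a s| ≤ Ma) ∧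
    (Δt / Δx) * (M1 + M2) + (2 * Δt / Δx ^ 2) * Ma + b * dlam clam lam * Δt / Δx ^ lam ≤ 1

/-- Standing assumptions on the data `f`, `a` and the numerical flux `f̂`. -/
structure SchemeData (f a : ℝ → ℝ) (fhat : ℝ → ℝ → ℝ) : Prop where
  hfLip : ∃ K : NNReal, LipschitzWith K f
  hf0 : f 0 = 0
  haLip : ∃ K : NNReal, LipschitzWith K a
  haNonneg : ∀ s : ℝ, 0 ≤ a s
  haBdd : ∃ M : ℝ, ∀ s : ℝ, a s ≤ M
  hfhatLip : ∃ K : NNReal, LipschitzWith K (fun p : ℝ × ℝ => fhat p.1 p.2)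
  hconsistent : ∀ u : ℝ, fhat u u = f u
  hmono1 : ∀ v : ℝ, Monotone (fun u => fhat u v)
  hmono2 : ∀ u : ℝ, Antitone (fun v => fhat u v)

/-- `W_i = f̂(U_i, U_{i+1}) − (A(U_{i+1}) − A(U_i))/Δx − b Σ_{k≤i} Σ_j G^k_j U_j`. -/
noncomputable def Wq (clam lam Δx b : ℝ) (fhat : ℝ → ℝ → ℝ) (a : ℝ → ℝ)
    (U : ℤ → ℝ) (i : ℤ) : ℝ :=
  fhat (U i) (U (i + 1)) - (Aint a (U (i + 1)) - Aint a (U i)) / Δx -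
    b * ∑' p : {k : ℤ // k ≤ i} × ℤ, Gw clam lam Δx p.1.val p.2 * U p.2

namespace WSup

/-- Singular kernel. -/
noncomputable def kk (l z : ℝ) : ℝ := 1 / |z| ^ (1 + l)

/-- Cell integral of `t ^ (-l)`. -/
noncomputable def EE (l h : ℝ) (m : ℕ) : ℝ := ∫ t in ((m : ℝ) * h)..(((m : ℝ) + 1) * h), t ^ (-l)

/-- Toeplitz symbol of the weights. -/
noncomputable def gk (c l h : ℝ) (m : ℤ) : ℝ :=
  if m = 0 then -(2 * c / l) * EE l h 0
  else (c / l) * (EE l h (m.natAbs - 1) - EE l h m.natAbs)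

lemma kk_neg (l z : ℝ) : kk l (-z) = kk l z := by simp [kk]

lemma kk_pos {l z : ℝ} (hz : 0 < z) : kk l z = z ^ (-(1 + l)) := by
  rw [kk, abs_of_pos hz, Real.rpow_neg hz.le, one_div]

lemma kk_Ici_integrable {l p : ℝ} (hl : 0 < l) (hp : 0 < p) : IntegrableOn (kk l) (Ici p) := by
  rw [integrableOn_Ici_iff_integrableOn_Ioi]
  refine (integrableOn_Ioi_rpow_of_lt (a := -(1 + l)) (by linarith) hp).congr_fun ?_ measurableSet_Ioi
  intro z hz
  exact (kk_pos (hp.trans hz)).symm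

lemma kk_Ici_integral {l p : ℝ} (hl : 0 < l) (hp : 0 < p) :
    ∫ z in Ici p, kk l z = p ^ (-l) / l := by
  rw [integral_Ici_eq_integral_Ioi]
  rw [setIntegral_congr_fun (g := fun z => z ^ (-(1 + l))) measurableSet_Ioi
    (fun z hz => kk_pos (hp.trans hz)), integral_Ioi_rpow_of_lt (by linarith) hp]
  rw [show -(1 + l) + 1 = -l by ring, neg_div_neg_eq]

lemma kk_Iic_integrable {l p : ℝ} (hl : 0 < l) (hp : 0 < p) : IntegrableOn (kk l) (Iic (-p)) := by
  have h := (Measure.measurePreserving_neg (volume : Measure ℝ)).integrableOn_comp_preimage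
    (Homeomorph.neg ℝ).measurableEmbedding (f := kk l) (s := Ici p)
  have h2 := h.2 (kk_Ici_integrable hl hp)
  have e1 : (kk l ∘ Neg.neg) = kk l := by ext z; simp [kk_neg]
  rw [e1] at h2
  simpa using h2

lemma kk_Iic_integral {l p : ℝ} (hl : 0 < l) (hp : 0 < p) :
    ∫ z in Iic (-p), kk l z = p ^ (-l) / l := by
  have := integral_comp_neg_Iic (-p) (kk l)
  simp only [kk_neg, neg_neg] at this
  rw [this, ← integral_Ici_eq_integral_Ioi, kk_Ici_integral hl hp]

lemma kk_Ioo_integral {l p q : ℝ} (hl : 0 < l) (hp : 0 < p) (hq : p ≤ q) :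
    ∫ z in Ioo p q, kk l z = (p ^ (-l) - q ^ (-l)) / l := by
  have hd : Ico p q ∪ Ici q = Ici p := Ico_union_Ici_eq_Ici hq
  have := setIntegral_union (f := kk l) (μ := volume) (s := Ico p q) (t := Ici q)
    (by rw [Set.disjoint_left]; intro z hz hz'; exact absurd hz.2 (not_lt.2 hz'))
    measurableSet_Ici ((kk_Ici_integrable hl hp).mono_set (by rw [← hd]; exact subset_union_left))
    (kk_Ici_integrable hl (hp.trans_le hq))
  rw [hd, kk_Ici_integral hl hp, kk_Ici_integral hl (hp.trans_le hq)] at this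
  rw [← integral_Ico_eq_integral_Ioo, sub_div]; linarith

lemma kk_Ioo_neg_integral {l p q : ℝ} (hl : 0 < l) (hp : 0 < p) (hq : p ≤ q) :
    ∫ z in Ioo (-q) (-p), kk l z = (p ^ (-l) - q ^ (-l)) / l := by
  rw [← kk_Ioo_integral hl hp hq, ← integral_Ioc_eq_integral_Ioo, ← integral_Ioc_eq_integral_Ioo,
    ← intervalIntegral.integral_of_le hq, ← intervalIntegral.integral_of_le (by linarith),
    ← intervalIntegral.integral_comp_neg]
  simp only [kk_neg]

lemma fracLap_full (c l : ℝ) (φ : ℝ → ℝ) (x : ℝ) :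
    fracLap c l φ x = c * ∫ z, (φ (x + z) - φ x) * kk l z := by
  unfold fracLap
  congr 1
  rw [setIntegral_congr_set (t := univ)]
  · simp [kk, div_eq_mul_inv]
  · exact ae_eq_univ.2 (by simp)

lemma fracLap_diag {c l α β x : ℝ} (hl : 0 < l) (h1 : α < x) (h2 : x < β) :
    fracLap c l (indicator (Ioo α β) 1) x = -(c / l) * ((x - α) ^ (-l) + (β - x) ^ (-l)) := by
  rw [fracLap_full]
  have e : (fun z => (indicator (Ioo α β) (1 : ℝ → ℝ) (x + z) - indicator (Ioo α β) (1 : ℝ → ℝ) x)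
      * kk l z) = fun z => -(indicator (Iic (-(x - α))) (kk l) z + indicator (Ici (β - x)) (kk l) z) := by
    ext z
    have hx : x ∈ Ioo α β := ⟨h1, h2⟩
    rw [indicator_of_mem hx]
    simp only [indicator, mem_Ioo, mem_Iic, mem_Ici, Pi.one_apply]
    split_ifs <;> first | (exfalso; grind) | ring
  rw [e, integral_neg, integral_add, integral_indicator measurableSet_Iic,
    integral_indicator measurableSet_Ici, kk_Iic_integral hl (by linarith),
    kk_Ici_integral hl (by linarith)]
  · ring
  · exact (integrable_indicator_iff measurableSet_Iic).2 (kk_Iic_integrable hl (by linarith))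
  · exact (integrable_indicator_iff measurableSet_Ici).2 (kk_Ici_integrable hl (by linarith))

lemma fracLap_off {c l α β x : ℝ} (hx : x ∉ Ioo α β) :
    fracLap c l (indicator (Ioo α β) 1) x = c * ∫ z in Ioo (α - x) (β - x), kk l z := by
  rw [fracLap_full, ← integral_indicator measurableSet_Ioo]
  congr 2
  ext z
  rw [indicator_of_notMem hx]
  simp only [indicator, mem_Ioo, Pi.one_apply]
  split_ifs <;> first | (exfalso; grind) | ring

lemma fracLap_right {c l α β x : ℝ} (hl : 0 < l) (hx : x < α) (h : α ≤ β) :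
    fracLap c l (indicator (Ioo α β) 1) x = (c / l) * ((α - x) ^ (-l) - (β - x) ^ (-l)) := by
  rw [fracLap_off (by intro h; exact absurd h.1 (not_lt.2 hx.le)),
    kk_Ioo_integral hl (by linarith) (by linarith)]
  ring

lemma fracLap_left {c l α β x : ℝ} (hl : 0 < l) (hx : β < x) (h : α ≤ β) :
    fracLap c l (indicator (Ioo α β) 1) x = (c / l) * ((x - β) ^ (-l) - (x - α) ^ (-l)) := by
  rw [fracLap_off (by intro h; exact absurd h.2 (not_lt.2 hx.le)),
    show α - x = -(x - α) by ring, show β - x = -(x - β) by ring,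
    kk_Ioo_neg_integral hl (by linarith) (by linarith)]
  ring

lemma ii_left {l : ℝ} (hl1 : l < 1) (q u v : ℝ) :
    IntervalIntegrable (fun x => (q - x) ^ (-l)) volume u v := by
  have := (intervalIntegral.intervalIntegrable_rpow' (a := q - u) (b := q - v) (r := -l)
    (by linarith)).comp_sub_left q
  simpa using this

lemma ii_right {l : ℝ} (hl1 : l < 1) (q u v : ℝ) :
    IntervalIntegrable (fun x => (x - q) ^ (-l)) volume u v := by
  have := (intervalIntegral.intervalIntegrable_rpow' (a := u - q) (b := v - q) (r := -l)
    (by linarith)).comp_sub_right q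
  simpa using this

lemma int_left {l h : ℝ} {i j : ℤ} {n : ℕ} (hn : j - i - 1 = n) :
    ∫ x in ((i : ℝ) * h)..(((i : ℝ) + 1) * h), ((j : ℝ) * h - x) ^ (-l) = EE l h n := by
  have : (n : ℝ) = j - i - 1 := by exact_mod_cast hn.symm
  rw [intervalIntegral.integral_comp_sub_left (fun x => x ^ (-l)), EE, this]
  congr 1 <;> ring

lemma int_right {l h : ℝ} {i j : ℤ} {n : ℕ} (hn : i - j = n) :
    ∫ x in ((i : ℝ) * h)..(((i : ℝ) + 1) * h), (x - (j : ℝ) * h) ^ (-l) = EE l h n := by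
  have : (n : ℝ) = i - j := by exact_mod_cast hn.symm
  rw [intervalIntegral.integral_comp_sub_right (fun x => x ^ (-l)), EE, this]
  congr 1 <;> ring

lemma Gw_eq {c l h : ℝ} (hl : 0 < l) (hl1 : l < 1) (hh : 0 < h) (i j : ℤ) :
    Gw c l h i j = gk c l h (i - j) := by
  have hle : (i : ℝ) * h ≤ ((i : ℝ) + 1) * h := by nlinarith
  have hlej : (j : ℝ) * h ≤ ((j : ℝ) + 1) * h := by nlinarith
  have hcast : ((j : ℝ) + 1) * h = ((j + 1 : ℤ) : ℝ) * h := by push_cast; ring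
  unfold Gw cellInd
  rcases lt_trichotomy i j with hij | hij | hij
  · have hij' : (i : ℝ) + 1 ≤ j := by exact_mod_cast hij
    have hm := mul_le_mul_of_nonneg_right hij' hh.le
    rw [setIntegral_congr_fun measurableSet_Ioo
      (fun x hx => fracLap_right hl (hx.2.trans_le hm) hlej), ← integral_Ioc_eq_integral_Ioo,
      ← intervalIntegral.integral_of_le hle, intervalIntegral.integral_const_mul,
      intervalIntegral.integral_sub (ii_left hl1 _ _ _) (ii_left hl1 _ _ _), hcast,
      int_left (n := (i - j).natAbs - 1) (by omega), int_left (n := (i - j).natAbs) (by omega), gk,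
      if_neg (by omega)]
  · subst hij
    rw [setIntegral_congr_fun measurableSet_Ioo
      (fun x hx => fracLap_diag hl hx.1 hx.2), ← integral_Ioc_eq_integral_Ioo,
      ← intervalIntegral.integral_of_le hle, intervalIntegral.integral_const_mul,
      intervalIntegral.integral_add (ii_right hl1 _ _ _) (ii_left hl1 _ _ _),
      int_right (n := 0) (by omega)]
    have := int_left (l := l) (h := h) (i := i) (j := i + 1) (n := 0) (by omega)
    push_cast at this
    rw [this, gk, if_pos (by omega)]
    ring
  · have hij' : (j : ℝ) + 1 ≤ i := by exact_mod_cast hij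
    have hm := mul_le_mul_of_nonneg_right hij' hh.le
    rw [setIntegral_congr_fun measurableSet_Ioo
      (fun x hx => fracLap_left hl (hm.trans_lt hx.1) hlej), ← integral_Ioc_eq_integral_Ioo,
      ← intervalIntegral.integral_of_le hle, intervalIntegral.integral_const_mul,
      intervalIntegral.integral_sub (ii_right hl1 _ _ _) (ii_right hl1 _ _ _), hcast,
      int_right (n := (i - j).natAbs - 1) (by omega), int_right (n := (i - j).natAbs) (by omega), gk,
      if_neg (by omega)]

lemma EE_anti {l h : ℝ} (hl : 0 < l) (hl1 : l < 1) (hh : 0 < h) (m : ℕ) :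
    EE l h (m + 1) ≤ EE l h m := by
  have hm : (0 : ℝ) ≤ (m : ℝ) * h := by positivity
  have e : EE l h (m + 1) = ∫ t in ((m : ℝ) * h)..(((m : ℝ) + 1) * h), (t - -h) ^ (-l) := by
    rw [intervalIntegral.integral_comp_sub_right (fun x => x ^ (-l)), EE]
    push_cast
    congr 1 <;> ring
  rw [e, EE]
  refine intervalIntegral.integral_mono_on_of_le_Ioo (by nlinarith) (ii_right hl1 _ _ _)
    (intervalIntegral.intervalIntegrable_rpow' (by linarith)) ?_
  intro t ht
  have : 0 < t := hm.trans_lt ht.1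
  exact Real.rpow_le_rpow_of_nonpos this (by linarith) (by linarith)

lemma EE_nonneg {l h : ℝ} (hh : 0 < h) (m : ℕ) : 0 ≤ EE l h m := by
  have hm : (0 : ℝ) ≤ (m : ℝ) * h := by positivity
  refine intervalIntegral.integral_nonneg (by nlinarith) fun t ht => ?_
  exact Real.rpow_nonneg (hm.trans ht.1) _

lemma EE_zero {l h : ℝ} (hl1 : l < 1) : EE l h 0 = h ^ (1 - l) / (1 - l) := by
  rw [EE, integral_rpow (Or.inl (by linarith))]
  simp only [CharP.cast_eq_zero, zero_mul, zero_add, one_mul]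
  rw [Real.zero_rpow (by linarith), show -l + 1 = 1 - l by ring, sub_zero]

lemma EE_tendsto {l h : ℝ} (hl : 0 < l) (hl1 : l < 1) (hh : 0 < h) :
    Tendsto (EE l h) atTop (nhds 0) := by
  have h1 : Tendsto (fun m : ℕ => ((m : ℝ) * h) ^ (-l) * h) atTop (nhds 0) := by
    have := (tendsto_rpow_neg_atTop hl).comp
      (tendsto_natCast_atTop_atTop (R := ℝ) |>.atTop_mul_const hh)
    simpa using this.mul_const h
  refine tendsto_of_tendsto_of_tendsto_of_le_of_le' tendsto_const_nhds h1
    (Eventually.of_forall fun m => EE_nonneg hh m) ?_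
  filter_upwards [eventually_gt_atTop 0] with m hm
  have hm' : (0 : ℝ) < (m : ℝ) * h := by positivity
  have : EE l h m ≤ ∫ t in ((m : ℝ) * h)..(((m : ℝ) + 1) * h), ((m : ℝ) * h) ^ (-l) := by
    refine intervalIntegral.integral_mono_on_of_le_Ioo (by nlinarith)
      (intervalIntegral.intervalIntegrable_rpow' (by linarith)) (by simp) ?_
    intro t ht
    exact Real.rpow_le_rpow_of_nonpos hm' ht.1.le (by linarith)
  refine this.trans (le_of_eq ?_)
  rw [intervalIntegral.integral_const, smul_eq_mul]
  ring

lemma gk_nonneg {c l h : ℝ} (hc : 0 < c) (hl : 0 < l) (hl1 : l < 1) (hh : 0 < h) {m : ℤ}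
    (hm : m ≠ 0) : 0 ≤ gk c l h m := by
  rw [gk, if_neg hm]
  have := EE_anti hl hl1 hh (m.natAbs - 1)
  rw [show m.natAbs - 1 + 1 = m.natAbs by omega] at this
  have : 0 ≤ EE l h (m.natAbs - 1) - EE l h m.natAbs := by linarith
  positivity

lemma gk_half {c l h : ℝ} (hl : 0 < l) (hl1 : l < 1) (hh : 0 < h) :
    HasSum (fun n : ℕ => (c / l) * (EE l h n - EE l h (n + 1))) ((c / l) * EE l h 0) := by
  refine HasSum.mul_left _ ?_
  rw [hasSum_iff_tendsto_nat_of_nonneg (fun n => by linarith [EE_anti hl hl1 hh n])]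
  simp only [Finset.sum_range_sub']
  simpa using (EE_tendsto hl hl1 hh).const_sub (EE l h 0)

lemma gk_hasSum {c l h : ℝ} (hl : 0 < l) (hl1 : l < 1) (hh : 0 < h) :
    HasSum (gk c l h) 0 := by
  have h1 : HasSum (fun n : ℕ => gk c l h ((n : ℤ) + 1)) ((c / l) * EE l h 0) := by
    convert gk_half (c := c) hl hl1 hh using 2 with n
    rw [gk, if_neg (by omega)]
    rw [show ((n : ℤ) + 1).natAbs = n + 1 by omega, show n + 1 - 1 = n by omega]
  have h2 : HasSum (fun n : ℕ => gk c l h (-((n : ℤ) + 1))) ((c / l) * EE l h 0) := by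
    convert gk_half (c := c) hl hl1 hh using 2 with n
    rw [gk, if_neg (by omega)]
    rw [show (-((n : ℤ) + 1)).natAbs = n + 1 by omega, show n + 1 - 1 = n by omega]
  have := HasSum.of_add_one_of_neg_add_one h1 h2
  convert this using 1
  rw [gk, if_pos rfl]; ring

lemma dlam_eq {c l : ℝ} (hl : 0 < l) (hl1 : l < 1) : dlam c l = c * (2 / (1 - l) + 2 / l) := by
  unfold dlam
  congr 2
  · have e : {z : ℝ | |z| < 1} = Ioo (-1) 1 := by ext z; simp [abs_lt]
    have hpos : ∫ z in (0:ℝ)..1, |z| ^ (-l) = 1 / (1 - l) := by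
      rw [intervalIntegral.integral_congr (g := fun z => z ^ (-l)), integral_rpow (Or.inl (by linarith))]
      · rw [Real.zero_rpow (by linarith), Real.one_rpow, show -l + 1 = 1 - l by ring, sub_zero]
      · intro z hz
        rw [uIcc_of_le zero_le_one] at hz
        simp only [abs_of_nonneg hz.1]
    have hneg : ∫ z in (-1:ℝ)..0, |z| ^ (-l) = 1 / (1 - l) := by
      have := intervalIntegral.integral_comp_neg (a := -1) (b := 0) (fun z : ℝ => |z| ^ (-l))
      simp only [abs_neg, neg_neg, neg_zero] at this
      rw [this, hpos]
    have hi : IntervalIntegrable (fun z : ℝ => |z| ^ (-l)) volume 0 1 := by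
      refine (intervalIntegral.intervalIntegrable_rpow' (r := -l) (by linarith)).congr ?_
      intro z hz
      rw [uIoc_of_le zero_le_one] at hz
      simp only [abs_of_nonneg hz.1.le]
    have hi' : IntervalIntegrable (fun z : ℝ => |z| ^ (-l)) volume (-1) 0 := by
      have := hi.comp_sub_left 0
      simp only [zero_sub, abs_neg, neg_zero] at this
      exact this.symm
    rw [e, ← integral_Ioc_eq_integral_Ioo, ← intervalIntegral.integral_of_le (by norm_num),
      ← intervalIntegral.integral_add_adjacent_intervals hi' hi, hpos, hneg]
    ring
  · have e : {z : ℝ | 1 < |z|} = Iio (-1) ∪ Ioi 1 := by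
      ext z; simp [lt_abs, or_comm, lt_neg]
    have ek : (fun z : ℝ => |z| ^ (-1 - l)) = kk l := by
      ext z; rw [kk, show -1 - l = -(1 + l) by ring, Real.rpow_neg (abs_nonneg z), one_div]
    have h1 := kk_Iic_integrable hl one_pos
    have h2 := kk_Ici_integrable hl one_pos
    rw [ek, e, setIntegral_union _ measurableSet_Ioi (h1.mono_set Iio_subset_Iic_self)
      (h2.mono_set Ioi_subset_Ici_self), ← integral_Iic_eq_integral_Iio,
      ← integral_Ici_eq_integral_Ioi, kk_Iic_integral hl one_pos, kk_Ici_integral hl one_pos,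
      Real.one_rpow]
    · ring
    · rw [Set.disjoint_left]; intro z hz hz'
      simp only [mem_Iio, mem_Ioi] at hz hz'; linarith

lemma gk_zero {c l h : ℝ} (hl : 0 < l) (hl1 : l < 1) (hh : 0 < h) :
    gk c l h 0 = -(dlam c l * h / h ^ l) := by
  rw [gk, if_pos rfl, dlam_eq hl hl1, EE_zero hl1, Real.rpow_sub hh, Real.rpow_one]
  have : 1 - l ≠ 0 := by linarith
  have : h ^ l ≠ 0 := (Real.rpow_pos_of_pos hh l).ne'
  field_simp
  ring

/-- Index change for the double series. -/
def idx (i : ℤ) : ℤ × ℕ ≃ {k : ℤ // k ≤ i} × ℤ where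
  toFun q := (⟨i - q.2, by omega⟩, i - q.2 - q.1)
  invFun p := (p.1.val - p.2, (i - p.1.val).toNat)
  left_inv q := by ext <;> simp
  right_inv p := by
    obtain ⟨⟨k, hk⟩, j⟩ := p
    ext <;> simp <;> omega

/-- Partial sums from the left. -/
noncomputable def TT (U : ℤ → ℝ) (i : ℤ) : ℝ := ∑' n : ℕ, U (i - n)

/-- Convolution with `g`. -/
noncomputable def cv (g U : ℤ → ℝ) (i : ℤ) : ℝ := ∑' m : ℤ, g m * U (i - m)

/-- The double series. -/
noncomputable def PP (g U : ℤ → ℝ) (i : ℤ) : ℝ :=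
  ∑' p : {k : ℤ // k ≤ i} × ℤ, g (p.1.val - p.2) * U p.2

lemma summable_pair {g U : ℤ → ℝ} (hg : Summable g) (hU : Summable U) :
    Summable (fun p : ℤ × ℤ => g (p.1 - p.2) * U p.2) := by
  have := summable_mul_of_summable_norm hg.norm hU.norm
  let e : ℤ × ℤ ≃ ℤ × ℤ :=
    { toFun := fun p => (p.1 - p.2, p.2), invFun := fun p => (p.1 + p.2, p.2),
      left_inv := fun p => by simp, right_inv := fun p => by simp }
  exact (e.summable_iff).2 this

lemma summable_half {g U : ℤ → ℝ} (hg : Summable g) (hU : Summable U) (i : ℤ) :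
    Summable (fun p : {k : ℤ // k ≤ i} × ℤ => g (p.1.val - p.2) * U p.2) := by
  have := (summable_pair hg hU).comp_injective (i := fun p : {k : ℤ // k ≤ i} × ℤ => (p.1.val, p.2))
    (by rintro ⟨⟨k, hk⟩, j⟩ ⟨⟨k', hk'⟩, j'⟩ h; simp at h ⊢; exact h)
  exact this

lemma summable_shift {U : ℤ → ℝ} (hU : Summable U) (i : ℤ) : Summable (fun n : ℕ => U (i - n)) :=
  hU.comp_injective (i := fun n : ℕ => i - (n : ℤ)) (by intro a b h; simpa using h)

lemma TT_sub {U : ℤ → ℝ} (hU : Summable U) (i : ℤ) : TT U i - TT U (i - 1) = U i := by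
  have := (summable_shift hU i).tsum_eq_zero_add
  rw [TT, this, TT]
  have e : ∀ n : ℕ, U (i - ((n + 1 : ℕ) : ℤ)) = U (i - 1 - n) := fun n => by congr 1; push_cast; ring
  rw [tsum_congr e]
  simp

lemma summable_cv {g W : ℤ → ℝ} (hg : Summable g) {C : ℝ} (hW : ∀ i, |W i| ≤ C) (i : ℤ) :
    Summable (fun m : ℤ => g m * W (i - m)) := by
  refine Summable.of_norm_bounded (hg.norm.mul_right C) fun m => ?_
  rw [norm_mul]
  exact mul_le_mul_of_nonneg_left (hW _) (norm_nonneg _)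

lemma TT_bdd {U : ℤ → ℝ} (hU : Summable U) (i : ℤ) : |TT U i| ≤ ∑' k, |U k| := by
  have hUa : Summable (fun k => |U k|) := hU.abs
  have h1 : Summable (fun n : ℕ => |U (i - n)|) := summable_shift hUa i
  have h2 : |TT U i| ≤ ∑' n : ℕ, |U (i - n)| := by
    have := norm_tsum_le_tsum_norm (f := fun n : ℕ => U (i - n)) h1
    simpa only [Real.norm_eq_abs, TT] using this
  refine h2.trans ?_
  have hinj : Function.Injective (fun n : ℕ => i - (n : ℤ)) := by intro a b h; simpa using h
  exact Summable.tsum_le_tsum_of_inj (f := fun n : ℕ => |U (i - n)|) (g := fun k => |U k|)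
    (fun n : ℕ => i - (n : ℤ)) hinj (fun c _ => abs_nonneg _) (fun n => le_rfl) h1 hUa

lemma PP_eq {g U : ℤ → ℝ} (hg : Summable g) (hU : Summable U) (i : ℤ) :
    PP g U i = cv g (TT U) i := by
  have hs := summable_half hg hU i
  have hs' := ((idx i).summable_iff).2 hs
  rw [PP, ← (idx i).tsum_eq, cv]
  have e : ∀ q : ℤ × ℕ, g ((idx i q).1.val - (idx i q).2) * U (idx i q).2
      = g q.1 * U (i - q.1 - q.2) := by
    intro q
    simp only [idx, Equiv.coe_fn_mk]
    congr 2 <;> ring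
  have hs'' : Summable (fun q : ℤ × ℕ => g q.1 * U (i - q.1 - q.2)) := by
    refine hs'.congr fun q => ?_
    exact (e q)
  rw [tsum_congr e, hs''.tsum_prod]
  refine tsum_congr fun m => ?_
  simp only [tsum_mul_left, TT]

lemma PP_diff {g U : ℤ → ℝ} (hg : Summable g) (hU : Summable U) (i : ℤ) :
    PP g U i - PP g U (i - 1) = cv g U i := by
  rw [PP_eq hg hU, PP_eq hg hU, cv, cv, cv,
    ← (summable_cv hg (TT_bdd hU) i).tsum_sub (summable_cv hg (TT_bdd hU) (i - 1))]
  refine tsum_congr fun m => ?_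
  rw [← TT_sub hU (i - m), show i - m - 1 = i - 1 - m by ring]; ring

lemma cv_alt (g U : ℤ → ℝ) (i : ℤ) : cv g U i = ∑' j : ℤ, g (i - j) * U j := by
  rw [cv, ← (Equiv.subLeft i).tsum_eq]
  refine tsum_congr fun m => ?_
  simp

lemma summable_cv_out {g U : ℤ → ℝ} (hg : Summable g) (hU : Summable U) : Summable (cv g U) := by
  have := (summable_pair hg hU).prod
  refine this.congr fun i => ?_
  rw [cv_alt]

lemma cv_TT {g W : ℤ → ℝ} (hg : HasSum g 0) {C : ℝ} (hW : ∀ i, |W i| ≤ C)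
    (hV : Summable (fun j => W j - W (j - 1))) (i : ℤ) :
    PP g (fun j => W j - W (j - 1)) i = cv g W i := by
  rw [PP_eq hg.summable hV]
  set V := fun j => W j - W (j - 1) with hVdef
  obtain ⟨K, hK⟩ : ∃ K, ∀ j, TT V j = W j + K := by
    refine ⟨TT V 0 - W 0, fun j => ?_⟩
    have step : ∀ j, TT V j - W j = TT V (j - 1) - W (j - 1) := fun j => by
      have := TT_sub hV j
      simp only [hVdef] at this ⊢; linarith
    have : TT V j - W j = TT V 0 - W 0 := by
      induction j using Int.induction_on with
      | zero => rfl
      | succ k ih => rw [step, show (k : ℤ) + 1 - 1 = k by ring, ih]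
      | pred k ih => rw [← step, ih]
    linarith
  have h1 := summable_cv hg.summable hW i
  have h2 := hg.mul_right K
  rw [cv, cv]
  have := h1.hasSum.add h2
  rw [zero_mul, add_zero] at this
  rw [← this.tsum_eq]
  refine tsum_congr fun m => ?_
  rw [hK]; ring

lemma PP_sub_smul {g U V : ℤ → ℝ} (hg : Summable g) (hU : Summable U) (hV : Summable V) (μ : ℝ)
    (i : ℤ) : PP g (fun j => U j - μ * V j) i = PP g U i - μ * PP g V i := by
  rw [PP, PP, PP, ← tsum_mul_left,
    ← (summable_half hg hU i).tsum_sub ((summable_half hg hV i).mul_left μ)]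
  refine tsum_congr fun p => ?_
  ring

lemma cv_bound {g W : ℤ → ℝ} (hg : HasSum g 0) (hpos : ∀ m, m ≠ 0 → 0 ≤ g m) {C : ℝ}
    (hW : ∀ i, |W i| ≤ C) (i : ℤ) : |cv g W i - g 0 * W i| ≤ -g 0 * C := by
  have h1 := (summable_cv hg.summable hW i).hasSum
  have h2 : HasSum (fun m : ℤ => if m = 0 then g 0 * W i else 0) (g 0 * W i) :=
    hasSum_ite_eq 0 _
  have h3 := h1.sub h2
  have h4 : HasSum (fun m : ℤ => g m * C - if m = 0 then g 0 * C else 0) (0 * C - g 0 * C) :=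
    (hg.mul_right C).sub (hasSum_ite_eq 0 _)
  have key : ∀ m : ℤ, ‖g m * W (i - m) - (if m = 0 then g 0 * W i else 0)‖
      ≤ g m * C - if m = 0 then g 0 * C else 0 := by
    intro m
    by_cases hm : m = 0
    · subst hm; simp
    · rw [if_neg hm, if_neg hm, sub_zero, sub_zero, norm_mul, Real.norm_of_nonneg (hpos m hm)]
      exact mul_le_mul_of_nonneg_left (hW _) (hpos m hm)
  have := tsum_of_norm_bounded h4 key
  rw [h3.tsum_eq] at this
  rw [Real.norm_eq_abs] at this
  unfold cv
  linarith

lemma slope {φ : ℝ → ℝ} (hφ : Monotone φ) {M : ℝ} (hM : 0 ≤ M)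
    (hL : ∀ x y, |φ x - φ y| ≤ M * |x - y|) (x y : ℝ) :
    ∃ α, 0 ≤ α ∧ α ≤ M ∧ φ x - φ y = α * (x - y) := by
  by_cases h : x = y
  · exact ⟨0, le_rfl, hM, by simp [h]⟩
  · have hne : x - y ≠ 0 := sub_ne_zero.2 h
    have hnn : 0 ≤ (φ x - φ y) / (x - y) := by
      rcases lt_or_gt_of_ne h with h | h
      · exact div_nonneg_of_nonpos (by linarith [hφ h.le]) (by linarith)
      · exact div_nonneg (by linarith [hφ h.le]) (by linarith)
    refine ⟨(φ x - φ y) / (x - y), hnn, ?_, by field_simp⟩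
    rw [← abs_of_nonneg hnn, abs_div, div_le_iff₀ (abs_pos.2 hne)]
    exact hL x y

lemma deriv_lip {φ : ℝ → ℝ} (hd : Differentiable ℝ φ) {M : ℝ} (hM : ∀ x, |deriv φ x| ≤ M)
    (x y : ℝ) : |φ x - φ y| ≤ M * |x - y| := by
  have := convex_univ.norm_image_sub_le_of_norm_deriv_le (f := φ) (C := M) (x := y) (y := x)
    (fun z _ => hd z) (fun z _ => hM z) (mem_univ _) (mem_univ _)
  simpa using this

lemma Aint_sub {a : ℝ → ℝ} (ha : Continuous a) (x y : ℝ) :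
    Aint a x - Aint a y = ∫ s in y..x, a s := by
  unfold Aint
  rw [intervalIntegral.integral_interval_sub_left] <;> exact ha.intervalIntegrable _ _

lemma Aint_mono {a : ℝ → ℝ} (ha : Continuous a) (h0 : ∀ s, 0 ≤ a s) : Monotone (Aint a) := by
  intro y x h
  have := intervalIntegral.integral_nonneg (μ := volume) h (fun s _ => h0 s)
  rw [← Aint_sub ha] at this
  linarith

lemma Aint_lip {a : ℝ → ℝ} (ha : Continuous a) {M : ℝ} (hM : ∀ s, |a s| ≤ M) (x y : ℝ) :
    |Aint a x - Aint a y| ≤ M * |x - y| := by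
  rw [Aint_sub ha, ← Real.norm_eq_abs]
  exact intervalIntegral.norm_integral_le_of_norm_le_const (fun s _ => (Real.norm_eq_abs _).trans_le (hM s))

lemma summable_add_int {U : ℤ → ℝ} (hU : Summable U) (r : ℤ) : Summable (fun i => U (i + r)) :=
  ((Equiv.addRight r).summable_iff (f := U)).2 hU

/-- The nonlocal flux-type quantity, with Toeplitz weights. -/
lemma Wq_eq {c l h b : ℝ} (hl : 0 < l) (hl1 : l < 1) (hh : 0 < h) (F : ℝ → ℝ → ℝ) (a : ℝ → ℝ)
    (U : ℤ → ℝ) (i : ℤ) : Wq c l h b F a U i =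
      F (U i) (U (i + 1)) - (Aint a (U (i + 1)) - Aint a (U i)) / h - b * PP (gk c l h) U i := by
  unfold Wq PP
  simp only [Gw_eq hl hl1 hh]

lemma step_eq {c l h b t : ℝ} (hl : 0 < l) (hl1 : l < 1) (hh : 0 < h) (F : ℝ → ℝ → ℝ) (a : ℝ → ℝ)
    {U : ℤ → ℝ} (hU : Summable U) (i : ℤ) : schemeStep c l h t b F a U i =
      U i - (t / h) * (Wq c l h b F a U i - Wq c l h b F a U (i - 1)) := by
  have hd := PP_diff (gk_hasSum (c := c) hl hl1 hh).summable hU i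
  rw [Wq_eq hl hl1 hh, Wq_eq hl hl1 hh, schemeStep]
  simp only [Gw_eq hl hl1 hh]
  rw [← cv_alt, ← hd, show i - 1 + 1 = i by ring]
  field_simp
  ring

lemma diff_summable {φ : ℤ → ℝ} {U : ℤ → ℝ} (hU : Summable U) {K : ℝ}
    (h : ∀ i, |φ i| ≤ K * (|U (i - 1)| + |U i| + |U (i + 1)|)) : Summable φ := by
  refine Summable.of_norm_bounded ((((summable_add_int hU.norm (-1)).add hU.norm).add
    (summable_add_int hU.norm 1)).mul_left K) fun i => ?_
  exact h i

lemma step_summable {c l h b t : ℝ} (hl : 0 < l) (hl1 : l < 1) (hh : 0 < h) {F : ℝ → ℝ → ℝ}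
    {a : ℝ → ℝ} {U : ℤ → ℝ} (hU : Summable U) {M1 M2 Ma : ℝ} (hM1 : 0 ≤ M1) (hM2 : 0 ≤ M2)
    (hF1 : ∀ v x y, |F x v - F y v| ≤ M1 * |x - y|)
    (hF2 : ∀ u x y, |F u x - F u y| ≤ M2 * |x - y|)
    (hA : ∀ x y, |Aint a x - Aint a y| ≤ Ma * |x - y|) :
    Summable (schemeStep c l h t b F a U) := by
  have hs1 : Summable (fun i => F (U i) (U (i + 1)) - F (U (i - 1)) (U i)) := by
    refine diff_summable hU (K := M1 + M2) fun i => ?_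
    have e : F (U i) (U (i + 1)) - F (U (i - 1)) (U i) =
      (F (U i) (U (i + 1)) - F (U (i - 1)) (U (i + 1))) +
      (F (U (i - 1)) (U (i + 1)) - F (U (i - 1)) (U i)) := by ring
    rw [e]
    refine (abs_add_le _ _).trans ?_
    have h1 := hF1 (U (i + 1)) (U i) (U (i - 1))
    have h2 := hF2 (U (i - 1)) (U (i + 1)) (U i)
    have h3 := mul_le_mul_of_nonneg_left (abs_sub (U i) (U (i - 1))) hM1
    have h4 := mul_le_mul_of_nonneg_left (abs_sub (U (i + 1)) (U i)) hM2
    nlinarith [mul_nonneg hM1 (abs_nonneg (U (i + 1))), mul_nonneg hM2 (abs_nonneg (U (i - 1)))]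
  have hs2 : Summable (fun i => Aint a (U i)) := by
    refine Summable.of_norm_bounded (hU.norm.mul_left Ma) fun i => ?_
    have := hA (U i) 0
    simpa [Aint] using this
  have hs3 : Summable (fun i => Aint a (U (i + 1)) - 2 * Aint a (U i) + Aint a (U (i - 1))) :=
    ((summable_add_int hs2 1).sub (hs2.mul_left 2)).add (summable_add_int hs2 (-1))
  have hs4 := summable_cv_out (gk_hasSum (c := c) hl hl1 hh).summable hU
  have := ((hU.sub (hs1.mul_left (t / h))).add (hs3.mul_left (t / h ^ 2))).add
    (hs4.mul_left (b * t / h))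
  refine this.congr fun i => ?_
  unfold schemeStep
  simp only [Gw_eq hl hl1 hh, cv_alt]

lemma step_bound {c l h b t : ℝ} (hc : 0 < c) (hl : 0 < l) (hl1 : l < 1) (hh : 0 < h) (ht : 0 < t)
    (hb : 0 ≤ b) {F : ℝ → ℝ → ℝ}
    {a : ℝ → ℝ} {U : ℤ → ℝ} (hU : Summable U) {M1 M2 Ma : ℝ} (hM1 : 0 ≤ M1) (hM2 : 0 ≤ M2)
    (hMa : 0 ≤ Ma)
    (hF1 : ∀ v x y, |F x v - F y v| ≤ M1 * |x - y|)
    (hF2 : ∀ u x y, |F u x - F u y| ≤ M2 * |x - y|)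
    (hA : ∀ x y, |Aint a x - Aint a y| ≤ Ma * |x - y|)
    (hm1 : ∀ v, Monotone (fun u => F u v)) (hm2 : ∀ u, Antitone (fun v => F u v))
    (hmA : Monotone (Aint a))
    (hcfl : (t / h) * (M1 + M2) + (2 * t / h ^ 2) * Ma + b * dlam c l * t / h ^ l ≤ 1)
    {C : ℝ} (hC : ∀ i, |Wq c l h b F a U i| ≤ C) (i : ℤ) :
    |Wq c l h b F a (schemeStep c l h t b F a U) i| ≤ C := by
  have hg := gk_hasSum (c := c) hl hl1 hh
  set U' := schemeStep c l h t b F a U with hU'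
  set W := Wq c l h b F a U with hW
  have hU's : Summable U' := step_summable hl hl1 hh hU hM1 hM2 hF1 hF2 hA
  have hst : ∀ j, U' j = U j - (t / h) * (W j - W (j - 1)) := fun j => step_eq hl hl1 hh F a hU j
  have hμ : 0 < t / h := div_pos ht hh
  have hV : Summable (fun j => W j - W (j - 1)) := by
    refine ((hU.sub hU's).mul_left (t / h)⁻¹).congr fun j => ?_
    rw [hst]; field_simp; ring
  have hP : PP (gk c l h) U' i = PP (gk c l h) U i - (t / h) * cv (gk c l h) W i := by
    rw [← cv_TT hg hC hV, ← PP_sub_smul hg.summable hU hV]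
    congr 1; ext j; exact hst j
  obtain ⟨α, hα0, hα1, hα⟩ := slope (hm1 (U' (i + 1))) hM1 (hF1 (U' (i + 1))) (U' i) (U i)
  obtain ⟨β, hβ0, hβ1, hβ⟩ := slope (φ := fun v => -F (U i) v) (hm2 (U i)).neg hM2
    (fun x y => by
      have := hF2 (U i) y x
      rw [abs_sub_comm x y]
      convert this using 2; ring) (U' (i + 1)) (U (i + 1))
  obtain ⟨p, hp0, hp1, hp⟩ := slope hmA hMa hA (U' i) (U i)
  obtain ⟨q, hq0, hq1, hq⟩ := slope hmA hMa hA (U' (i + 1)) (U (i + 1))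
  have d0 : U' i - U i = -(t / h) * (W i - W (i - 1)) := by rw [hst]; ring
  have d1 : U' (i + 1) - U (i + 1) = -(t / h) * (W (i + 1) - W i) := by
    rw [hst, show i + 1 - 1 = i by ring]; ring
  simp only [d0] at hα hp
  simp only [d1] at hβ hq
  set R := cv (gk c l h) W i - gk c l h 0 * W i with hR
  have hRb : |R| ≤ -gk c l h 0 * C :=
    cv_bound hg (fun m hm => gk_nonneg hc hl hl1 hh hm) hC i
  set μ := t / h with hμd
  set g0 := gk c l h 0 with hg0
  have hWi := Wq_eq (c := c) (b := b) hl hl1 hh F a U i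
  have expr : Wq c l h b F a U' i =
      (1 - μ * α - μ * β - μ * (p + q) / h + b * μ * g0) * W i + (μ * (α + p / h)) * W (i - 1)
      + (μ * (β + q / h)) * W (i + 1) + b * μ * R := by
    rw [Wq_eq hl hl1 hh, hP]
    have e1 : F (U' i) (U' (i + 1)) = F (U i) (U (i + 1)) + α * (-μ * (W i - W (i - 1)))
      - β * (-μ * (W (i + 1) - W i)) + (0 : ℝ) := by linarith
    have e2 : Aint a (U' (i + 1)) = Aint a (U (i + 1)) + q * (-μ * (W (i + 1) - W i)) := by linarith
    have e3 : Aint a (U' i) = Aint a (U i) + p * (-μ * (W i - W (i - 1))) := by linarith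
    have e4 : F (U i) (U (i + 1)) = W i + (Aint a (U (i + 1)) - Aint a (U i)) / h
      + b * PP (gk c l h) U i := by rw [hW, hWi]; ring
    rw [e1, e2, e3, e4, hR]
    ring
  have hg0e : b * μ * g0 = -(b * dlam c l * t / h ^ l) := by
    rw [hg0, gk_zero hl hl1 hh, hμd]
    field_simp
  have hcoef : 0 ≤ 1 - μ * α - μ * β - μ * (p + q) / h + b * μ * g0 := by
    rw [hg0e]
    have h1 := mul_le_mul_of_nonneg_left hα1 hμ.le
    have h2 := mul_le_mul_of_nonneg_left hβ1 hμ.le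
    have h3 : μ * (p + q) / h ≤ (2 * t / h ^ 2) * Ma := by
      have : (2 * t / h ^ 2) * Ma = μ * (Ma + Ma) / h := by rw [hμd]; field_simp; ring
      rw [this]; gcongr
    linarith
  have hc1 : 0 ≤ μ * (α + p / h) := by positivity
  have hc2 : 0 ≤ μ * (β + q / h) := by positivity
  have hc3 : 0 ≤ b * μ := by positivity
  rw [expr]
  have b1 := mul_le_mul_of_nonneg_left (hC i) hcoef
  have b2 := mul_le_mul_of_nonneg_left (hC (i - 1)) hc1
  have b3 := mul_le_mul_of_nonneg_left (hC (i + 1)) hc2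
  have b4 := mul_le_mul_of_nonneg_left hRb hc3
  calc _ ≤ |(1 - μ * α - μ * β - μ * (p + q) / h + b * μ * g0) * W i|
        + |(μ * (α + p / h)) * W (i - 1)| + |(μ * (β + q / h)) * W (i + 1)| + |b * μ * R| := by
        refine (abs_add_le _ _).trans (add_le_add_left ?_ _)
        refine (abs_add_le _ _).trans (add_le_add_left ?_ _)
        exact abs_add_le _ _
    _ ≤ _ := by
        rw [abs_mul _ (W i), abs_mul _ (W (i - 1)), abs_mul _ (W (i + 1)), abs_mul _ R, abs_of_nonneg hcoef, abs_of_nonneg hc1,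
          abs_of_nonneg hc2, abs_of_nonneg hc3]
        refine (add_le_add (add_le_add (add_le_add b1 b2) b3) b4).trans (le_of_eq ?_)
        ring

lemma init_summable {h : ℝ} (hh : 0 < h) {u : ℝ → ℝ} (hu : Integrable u) :
    Summable (fun i : ℤ => (1 / h) * ∫ x in Ioo ((i : ℝ) * h) (((i : ℝ) + 1) * h), u x) := by
  refine Summable.mul_left _ ?_
  refine (hasSum_integral_iUnion (fun i => measurableSet_Ioo) ?_ hu.integrableOn).summable
  intro i j hij
  rw [Function.onFun, Set.disjoint_left]
  rintro x ⟨h1, h2⟩ ⟨h3, h4⟩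
  have a1 : (i : ℝ) < j + 1 := lt_of_mul_lt_mul_right (h1.trans h4) hh.le
  have a2 : (j : ℝ) < i + 1 := lt_of_mul_lt_mul_right (h3.trans h2) hh.le
  have a1' : i < j + 1 := by exact_mod_cast a1
  have a2' : j < i + 1 := by exact_mod_cast a2
  omega

end WSup

/-- Under the CFL condition the double series defining `W_i^n` converges absolutely and
`sup_i |W_i^n| ≤ sup_i |W_i^0|` for every `n`. -/
theorem W_sup_stability (lam : ℝ) (hlam : lam ∈ Set.Ioo (0 : ℝ) 1)
    (clam : ℝ) (hclam : 0 < clam) (Δx Δt : ℝ) (hΔx : 0 < Δx) (hΔt : 0 < Δt)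
    (b : ℝ) (hb : 0 ≤ b) (f a : ℝ → ℝ) (fhat : ℝ → ℝ → ℝ)
    (hdata : SchemeData f a fhat) (hfC1 : ContDiff ℝ 1 f)
    (u₀ : ℝ → ℝ) (hu₀1 : Integrable u₀) (hu₀bv : eVariationOn u₀ Set.univ ≠ ⊤)
    (hcfl : CFL clam lam Δx Δt b fhat a) :
    ∀ n : ℕ,
      (∀ i : ℤ, Summable (fun p : {k : ℤ // k ≤ i} × ℤ =>
        |Gw clam lam Δx p.1.val p.2 * Uiter clam lam Δx Δt b fhat a u₀ n p.2|)) ∧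
      (∀ C : ℝ,
        (∀ i : ℤ, |Wq clam lam Δx b fhat a (Uiter clam lam Δx Δt b fhat a u₀ 0) i| ≤ C) →
        ∀ i : ℤ, |Wq clam lam Δx b fhat a (Uiter clam lam Δx Δt b fhat a u₀ n) i| ≤ C) := by
  obtain ⟨hl, hl1⟩ := hlam
  obtain ⟨hC1, M1, M2, Ma, h1, h2, h3, hcfl⟩ := hcfl
  obtain ⟨Ka, hKa⟩ := hdata.haLip
  have hM1 : 0 ≤ M1 := (abs_nonneg _).trans (h1 0 0)
  have hM2 : 0 ≤ M2 := (abs_nonneg _).trans (h2 0 0)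
  have hMa : 0 ≤ Ma := (abs_nonneg _).trans (h3 0)
  have hd := hC1.differentiable one_ne_zero
  have hF1 : ∀ v x y, |fhat x v - fhat y v| ≤ M1 * |x - y| := fun v x y =>
    WSup.deriv_lip (φ := fun s => fhat s v)
      (hd.comp (differentiable_id.prodMk (differentiable_const v))) (fun s => h1 s v) x y
  have hF2 : ∀ u x y, |fhat u x - fhat u y| ≤ M2 * |x - y| := fun u x y =>
    WSup.deriv_lip (φ := fun s => fhat u s)
      (hd.comp ((differentiable_const u).prodMk differentiable_id)) (fun s => h2 u s) x y
  have hA := WSup.Aint_lip hKa.continuous h3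
  have hsum : ∀ n, Summable (Uiter clam lam Δx Δt b fhat a u₀ n) := by
    intro n
    induction n with
    | zero => exact WSup.init_summable hΔx hu₀1
    | succ n ih => exact WSup.step_summable hl hl1 hΔx ih hM1 hM2 hF1 hF2 hA
  intro n
  constructor
  · intro i
    simp only [WSup.Gw_eq hl hl1 hΔx]
    exact (WSup.summable_half (WSup.gk_hasSum hl hl1 hΔx).summable (hsum n) i).abs
  · intro C hC
    induction n with
    | zero => exact hC
    | succ n ih =>
      exact WSup.step_bound hclam hl hl1 hΔx hΔt hb (hsum n) hM1 hM2 hMa hF1 hF2 hA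
        hdata.hmono1 hdata.hmono2 (WSup.Aint_mono hKa.continuous hdata.haNonneg) hcfl ih
end

section
/- Assume u₀ ∈ L¹(ℝ) ∩ BV(ℝ), that f is continuously differentiable, and that the CFL condition holds. Then for every integer n ≥ 0, Σ_{i∈ℤ} |W_{i+1}^n − W_i^n| ≤ Σ_{i∈ℤ} |W_{i+1}^0 − W_i^0|. -/
open MeasureTheory Filter Set

namespace WBV

lemma K_Ici {lam : ℝ} (hl : 0 < lam) {β : ℝ} (hβ : 0 < β) :
    IntegrableOn (fun z : ℝ => 1 / |z| ^ (1 + lam)) (Ici β) ∧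
    ∫ z in Ici β, 1 / |z| ^ (1 + lam) = β ^ (-lam) / lam := by
  have e : EqOn (fun z : ℝ => z ^ (-1 - lam)) (fun z : ℝ => 1 / |z| ^ (1 + lam)) (Ioi β) := by
    intro z hz
    have hz0 : 0 < z := lt_trans hβ hz
    simp only
    rw [abs_of_pos hz0, one_div, ← Real.rpow_neg hz0.le]
    congr 1; ring
  have h1 := integrableOn_Ioi_rpow_of_lt (a := -1 - lam) (by linarith) hβ
  constructor
  · rw [integrableOn_Ici_iff_integrableOn_Ioi]
    exact h1.congr_fun e measurableSet_Ioi
  · rw [integral_Ici_eq_integral_Ioi, ← setIntegral_congr_fun measurableSet_Ioi e,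
      integral_Ioi_rpow_of_lt (by linarith) hβ]
    have : -1 - lam + 1 = -lam := by ring
    rw [this, neg_div_neg_eq]

lemma K_Iic {lam : ℝ} (hl : 0 < lam) {α : ℝ} (hα : 0 < α) :
    IntegrableOn (fun z : ℝ => 1 / |z| ^ (1 + lam)) (Iic (-α)) ∧
    ∫ z in Iic (-α), 1 / |z| ^ (1 + lam) = α ^ (-lam) / lam := by
  obtain ⟨h1, h2⟩ := K_Ici hl hα
  constructor
  · have := (Measure.measurePreserving_neg (volume : Measure ℝ)).integrableOn_comp_preimage
      (Homeomorph.neg ℝ).measurableEmbedding (f := fun z : ℝ => 1 / |z| ^ (1 + lam)) (s := Ici α)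
    have h3 := this.2 h1
    have e1 : (Neg.neg ⁻¹' (Ici α) : Set ℝ) = Iic (-α) := by ext; simp
    rw [e1] at h3
    refine h3.congr_fun ?_ measurableSet_Iic
    intro z _; simp
  · have h3 := integral_comp_neg_Iic (-α) (fun z : ℝ => 1 / |z| ^ (1 + lam))
    simp only [abs_neg, neg_neg] at h3
    rw [h3, ← integral_Ici_eq_integral_Ioi, h2]

lemma K_far {lam : ℝ} (hl : 0 < lam) {α β : ℝ} (hα : 0 < α) (hβ : 0 < β) :
    IntegrableOn (fun z : ℝ => 1 / |z| ^ (1 + lam)) (Iic (-α) ∪ Ici β) ∧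
    ∫ z in Iic (-α) ∪ Ici β, 1 / |z| ^ (1 + lam) = α ^ (-lam) / lam + β ^ (-lam) / lam := by
  obtain ⟨h1, h2⟩ := K_Ici hl hβ
  obtain ⟨h3, h4⟩ := K_Iic hl hα
  refine ⟨h3.union h1, ?_⟩
  rw [setIntegral_union ?_ measurableSet_Ici h3 h1, h2, h4]
  rw [Set.disjoint_left]
  intro z hz hz'
  simp only [mem_Iic, mem_Ici] at hz hz'
  linarith

lemma dlam_eq {clam lam : ℝ} (hl : 0 < lam) (hl1 : lam < 1) :
    dlam clam lam = clam * (2 / (1 - lam) + 2 / lam) := by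
  unfold dlam
  have hA : (∫ z in {z : ℝ | |z| < 1}, |z| ^ (-lam)) = 2 / (1 - lam) := by
    have hm : MeasurableSet {z : ℝ | |z| < 1} := measurableSet_lt (by fun_prop) (by fun_prop)
    rw [← integral_indicator hm]
    have h := integral_comp_abs (f := fun z : ℝ => indicator (Iio 1) (fun z => z ^ (-lam)) z)
    have e : (fun z : ℝ => indicator (Iio 1) (fun z => z ^ (-lam)) |z|) =
        indicator {z : ℝ | |z| < 1} (fun z => |z| ^ (-lam)) := by
      ext z; simp [indicator]
    rw [e] at h
    rw [h, setIntegral_indicator measurableSet_Iio, Ioi_inter_Iio, ← integral_Ioc_eq_integral_Ioo,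
      ← intervalIntegral.integral_of_le zero_le_one, integral_rpow (by left; linarith),
      Real.zero_rpow (by linarith), Real.one_rpow]
    have : -lam + 1 = 1 - lam := by ring
    rw [this]; ring
  have hB : (∫ z in {z : ℝ | 1 < |z|}, |z| ^ (-1 - lam)) = 2 / lam := by
    have hm : MeasurableSet {z : ℝ | 1 < |z|} := measurableSet_lt (by fun_prop) (by fun_prop)
    rw [← integral_indicator hm]
    have h := integral_comp_abs (f := fun z : ℝ => indicator (Ioi 1) (fun z => z ^ (-1 - lam)) z)
    have e : (fun z : ℝ => indicator (Ioi 1) (fun z => z ^ (-1 - lam)) |z|) =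
        indicator {z : ℝ | 1 < |z|} (fun z => |z| ^ (-1 - lam)) := by
      ext z; simp [indicator]
    rw [e] at h
    rw [h, setIntegral_indicator measurableSet_Ioi]
    have : Ioi (0:ℝ) ∩ Ioi 1 = Ioi 1 := by
      ext z; simp only [mem_inter_iff, mem_Ioi]; constructor
      · exact fun h => h.2
      · exact fun h => ⟨by linarith, h⟩
    rw [this, integral_Ioi_rpow_of_lt (by linarith) one_pos, Real.one_rpow]
    have : -1 - lam + 1 = -lam := by ring
    rw [this, neg_div_neg_eq]; ring
  rw [hA, hB]

/-- the cell -/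
def cell (Δx : ℝ) (i : ℤ) : Set ℝ := Ioo ((i : ℝ) * Δx) (((i : ℝ) + 1) * Δx)

lemma cell_disj {Δx : ℝ} (hΔx : 0 < Δx) {i j : ℤ} (h : i ≠ j) {x : ℝ} (hx : x ∈ cell Δx i) :
    x ∉ cell Δx j := by
  intro hx'
  obtain ⟨h1, h2⟩ := hx
  obtain ⟨h3, h4⟩ := hx'
  have h5 : (i : ℝ) < j + 1 := lt_of_mul_lt_mul_right (h1.trans h4) hΔx.le
  have h6 : (j : ℝ) < i + 1 := lt_of_mul_lt_mul_right (h3.trans h2) hΔx.le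
  have h7 : i < j + 1 := by exact_mod_cast h5
  have h8 : j < i + 1 := by exact_mod_cast h6
  omega

lemma cellInd_of_mem {Δx : ℝ} {j : ℤ} {x : ℝ} (hx : x ∈ cell Δx j) : cellInd Δx j x = 1 := by
  unfold cellInd; exact indicator_of_mem hx _

lemma cellInd_of_notMem {Δx : ℝ} {j : ℤ} {x : ℝ} (hx : x ∉ cell Δx j) : cellInd Δx j x = 0 := by
  unfold cellInd; exact indicator_of_notMem hx _

lemma cellInd_nonneg {Δx : ℝ} {j : ℤ} {x : ℝ} : 0 ≤ cellInd Δx j x := by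
  by_cases h : x ∈ cell Δx j
  · rw [cellInd_of_mem h]; norm_num
  · rw [cellInd_of_notMem h]

lemma cellInd_le_one {Δx : ℝ} {j : ℤ} {x : ℝ} : cellInd Δx j x ≤ 1 := by
  by_cases h : x ∈ cell Δx j
  · rw [cellInd_of_mem h]
  · rw [cellInd_of_notMem h]; norm_num

@[fun_prop]
lemma cellInd_meas {Δx : ℝ} {j : ℤ} : Measurable (cellInd Δx j) :=
  measurable_one.indicator measurableSet_Ioo

lemma cellInd_const {Δx : ℝ} (hΔx : 0 < Δx) {i j : ℤ} {x y : ℝ} (hx : x ∈ cell Δx i)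
    (hy : y ∈ cell Δx i) : cellInd Δx j x = cellInd Δx j y := by
  by_cases h : i = j
  · subst h; rw [cellInd_of_mem hx, cellInd_of_mem hy]
  · rw [cellInd_of_notMem (cell_disj hΔx h hx), cellInd_of_notMem (cell_disj hΔx h hy)]

/-- for x in cell i, far set -/
def far (Δx : ℝ) (i : ℤ) (x : ℝ) : Set ℝ :=
  Iic (-(x - (i : ℝ) * Δx)) ∪ Ici (((i : ℝ) + 1) * Δx - x)

lemma far_meas {Δx : ℝ} {i : ℤ} {x : ℝ} : MeasurableSet (far Δx i x) :=
  measurableSet_Iic.union measurableSet_Ici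

lemma mem_far {Δx : ℝ} {i : ℤ} {x z : ℝ} : z ∈ far Δx i x ↔ x + z ∉ cell Δx i := by
  simp only [far, cell, mem_union, mem_Iic, mem_Ici, mem_Ioo, not_and_or, not_lt]
  constructor
  · rintro (h | h)
    · left; linarith
    · right; linarith
  · rintro (h | h)
    · left; linarith
    · right; linarith

lemma integrand_int {lam Δx : ℝ} (hl : 0 < lam) (hΔx : 0 < Δx) {i : ℤ} (j : ℤ) {x : ℝ}
    (hx : x ∈ cell Δx i) :
    Integrable (fun z => (cellInd Δx j (x + z) - cellInd Δx j x) / |z| ^ (1 + lam)) := by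
  have h1 := (K_far (α := x - (i : ℝ) * Δx) (β := ((i : ℝ) + 1) * Δx - x) hl
    (by linarith [hx.1]) (by linarith [hx.2])).1
  have h2 : Integrable (indicator (far Δx i x) fun z : ℝ => 1 / |z| ^ (1 + lam)) :=
    h1.integrable_indicator far_meas
  refine h2.mono' ?_ ?_
  · refine Measurable.aestronglyMeasurable ?_
    fun_prop
  · refine Eventually.of_forall fun z => ?_
    by_cases hz : z ∈ far Δx i x
    · rw [indicator_of_mem hz, norm_div, Real.norm_of_nonneg (Real.rpow_nonneg (abs_nonneg z) _)]
      gcongr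
      rw [Real.norm_eq_abs, abs_le]
      have := @cellInd_nonneg Δx j x
      have := @cellInd_nonneg Δx j (x + z)
      have := @cellInd_le_one Δx j x
      have := @cellInd_le_one Δx j (x + z)
      constructor <;> linarith
    · have : x + z ∈ cell Δx i := by
        by_contra h; exact hz (mem_far.2 h)
      rw [indicator_of_notMem hz, cellInd_const hΔx this hx]
      simp

lemma fracLap_eq {clam lam : ℝ} {φ : ℝ → ℝ} {x : ℝ} :
    fracLap clam lam φ x = clam * ∫ z, (φ (x + z) - φ x) / |z| ^ (1 + lam) := by
  unfold fracLap
  rw [restrict_compl_singleton]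

lemma fracLap_diag {clam lam Δx : ℝ} (hl : 0 < lam) {i : ℤ} {x : ℝ}
    (hx : x ∈ cell Δx i) :
    fracLap clam lam (cellInd Δx i) x =
      -(clam / lam) * ((x - (i : ℝ) * Δx) ^ (-lam) + (((i : ℝ) + 1) * Δx - x) ^ (-lam)) := by
  rw [fracLap_eq]
  have h1 := (K_far (α := x - (i : ℝ) * Δx) (β := ((i : ℝ) + 1) * Δx - x) hl
    (by linarith [hx.1]) (by linarith [hx.2])).2
  have e : (fun z => (cellInd Δx i (x + z) - cellInd Δx i x) / |z| ^ (1 + lam)) =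
      fun z => - (indicator (far Δx i x) (fun z : ℝ => 1 / |z| ^ (1 + lam)) z) := by
    ext z
    rw [cellInd_of_mem hx]
    by_cases hz : z ∈ far Δx i x
    · rw [indicator_of_mem hz, cellInd_of_notMem (mem_far.1 hz)]; ring
    · have : x + z ∈ cell Δx i := by
        by_contra h; exact hz (mem_far.2 h)
      rw [indicator_of_notMem hz, cellInd_of_mem this]
      simp
  rw [e, integral_neg, integral_indicator far_meas, far, h1]
  ring

lemma fracLap_off_nonneg {clam lam Δx : ℝ} (hc : 0 < clam) (hΔx : 0 < Δx) {i j : ℤ} (hij : i ≠ j)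
    {x : ℝ} (hx : x ∈ cell Δx i) : 0 ≤ fracLap clam lam (cellInd Δx j) x := by
  rw [fracLap_eq, cellInd_of_notMem (cell_disj hΔx hij hx)]
  refine mul_nonneg hc.le (integral_nonneg fun z => ?_)
  simp only [sub_zero]
  exact div_nonneg cellInd_nonneg (Real.rpow_nonneg (abs_nonneg z) _)

lemma cellInd_sum_le {Δx : ℝ} (hΔx : 0 < Δx) (F : Finset ℤ) (y : ℝ) :
    ∑ j ∈ F, cellInd Δx j y ≤ 1 := by
  by_cases h : ∃ i, y ∈ cell Δx i
  · obtain ⟨i, hi⟩ := h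
    have : ∀ j ∈ F, cellInd Δx j y = if j = i then 1 else 0 := by
      intro j _
      split_ifs with h
      · subst h; exact cellInd_of_mem hi
      · exact cellInd_of_notMem (cell_disj hΔx (Ne.symm h) hi)
    rw [Finset.sum_congr rfl this, Finset.sum_ite_eq']
    split_ifs <;> norm_num
  · push Not at h
    rw [Finset.sum_eq_zero fun j _ => cellInd_of_notMem (h j)]
    norm_num

lemma fracLap_sum_nonpos {clam lam Δx : ℝ} (hl : 0 < lam) (hc : 0 < clam) (hΔx : 0 < Δx) {i : ℤ}
    (F : Finset ℤ) (hF : i ∈ F) {x : ℝ} (hx : x ∈ cell Δx i) :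
    ∑ j ∈ F, fracLap clam lam (cellInd Δx j) x ≤ 0 := by
  simp only [fracLap_eq]
  rw [← Finset.mul_sum, ← integral_finsetSum _ fun j _ => integrand_int hl hΔx j hx]
  refine mul_nonpos_of_nonneg_of_nonpos hc.le (integral_nonpos fun z => ?_)
  simp only [Pi.zero_apply]
  rw [← Finset.sum_div]
  refine div_nonpos_of_nonpos_of_nonneg ?_ (Real.rpow_nonneg (abs_nonneg z) _)
  rw [Finset.sum_sub_distrib]
  have h1 := cellInd_sum_le hΔx F (x + z)
  have h2 : 1 ≤ ∑ j ∈ F, cellInd Δx j x := by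
    rw [← cellInd_of_mem hx]
    exact Finset.single_le_sum (f := fun j => cellInd Δx j x) (fun j _ => cellInd_nonneg) hF
  linarith

lemma diag_int {clam lam Δx : ℝ} (hl : 0 < lam) (hl1 : lam < 1) (hΔx : 0 < Δx) (i : ℤ) :
    IntegrableOn (fracLap clam lam (cellInd Δx i)) (cell Δx i) ∧
    Gw clam lam Δx i i = - (dlam clam lam * Δx ^ (1 - lam)) := by
  have hle : (i : ℝ) * Δx ≤ ((i : ℝ) + 1) * Δx := by nlinarith
  have e : EqOn (fun x => -(clam / lam) *
      ((x - (i : ℝ) * Δx) ^ (-lam) + (((i : ℝ) + 1) * Δx - x) ^ (-lam)))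
      (fracLap clam lam (cellInd Δx i)) (cell Δx i) := fun x hx => (fracLap_diag hl hx).symm
  have hi0 : IntervalIntegrable (fun x : ℝ => x ^ (-lam)) volume 0 Δx :=
    intervalIntegral.intervalIntegrable_rpow' (by linarith)
  have hi1 : IntervalIntegrable (fun x : ℝ => (x - (i : ℝ) * Δx) ^ (-lam)) volume
      ((i : ℝ) * Δx) (((i : ℝ) + 1) * Δx) := by
    have := hi0.comp_sub_right ((i : ℝ) * Δx)
    convert this using 1 <;> ring
  have hi2 : IntervalIntegrable (fun x : ℝ => (((i : ℝ) + 1) * Δx - x) ^ (-lam)) volume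
      ((i : ℝ) * Δx) (((i : ℝ) + 1) * Δx) := by
    have := (hi0.comp_sub_left (((i : ℝ) + 1) * Δx)).symm
    convert this using 1 <;> ring
  have hv0 : ∫ x in (0:ℝ)..Δx, x ^ (-lam) = Δx ^ (1 - lam) / (1 - lam) := by
    rw [integral_rpow (by left; linarith), Real.zero_rpow (by linarith)]
    have : -lam + 1 = 1 - lam := by ring
    rw [this, sub_zero]
  have hi := (hi1.add hi2).const_mul (-(clam / lam))
  constructor
  · have := (intervalIntegrable_iff_integrableOn_Ioo_of_le hle).1 hi
    exact this.congr_fun e measurableSet_Ioo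
  · unfold Gw
    have h1 : ∫ x in cell Δx i, fracLap clam lam (cellInd Δx i) x = 
      ∫ x in ((i : ℝ) * Δx)..(((i : ℝ) + 1) * Δx), -(clam / lam) *
      ((x - (i : ℝ) * Δx) ^ (-lam) + (((i : ℝ) + 1) * Δx - x) ^ (-lam)) := by
      rw [intervalIntegral.integral_of_le hle, integral_Ioc_eq_integral_Ioo,
        ← setIntegral_congr_fun (s := cell Δx i) measurableSet_Ioo e]
      rfl
    change ∫ x in cell Δx i, fracLap clam lam (cellInd Δx i) x = _
    rw [h1, intervalIntegral.integral_const_mul, intervalIntegral.integral_add hi1 hi2,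
      intervalIntegral.integral_comp_sub_right (fun x : ℝ => x ^ (-lam)),
      intervalIntegral.integral_comp_sub_left (fun x : ℝ => x ^ (-lam))]
    have e1 : (i : ℝ) * Δx - i * Δx = 0 := by ring
    have e2 : ((i : ℝ) + 1) * Δx - i * Δx = Δx := by ring
    have e3 : ((i : ℝ) + 1) * Δx - (i + 1) * Δx = 0 := by ring
    rw [e1, e2, e3, hv0, dlam_eq hl hl1]
    have : 1 - lam ≠ 0 := by linarith
    field_simp
    ring

lemma fracLap_meas {clam lam Δx : ℝ} (j : ℤ) : Measurable (fracLap clam lam (cellInd Δx j)) := by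
  have : fracLap clam lam (cellInd Δx j) = fun x => clam * ∫ z, (cellInd Δx j (x + z) - cellInd Δx j x) / |z| ^ (1 + lam) := by
    ext x; exact fracLap_eq
  rw [this]
  refine Measurable.const_mul ?_ _
  refine StronglyMeasurable.measurable ?_
  refine StronglyMeasurable.integral_prod_right (f := fun x z => (cellInd Δx j (x + z) - cellInd Δx j x) / |z| ^ (1 + lam)) ?_
  refine Measurable.stronglyMeasurable ?_
  simp only [Function.uncurry_def]
  fun_prop

lemma fracLap_int {clam lam Δx : ℝ} (hl : 0 < lam) (hl1 : lam < 1) (hc : 0 < clam) (hΔx : 0 < Δx)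
    (i j : ℤ) : IntegrableOn (fracLap clam lam (cellInd Δx j)) (cell Δx i) := by
  by_cases h : i = j
  · subst h; exact (diag_int hl hl1 hΔx i).1
  · refine Integrable.mono' (g := fun x => - fracLap clam lam (cellInd Δx i) x) (diag_int hl hl1 hΔx i).1.neg
      (fracLap_meas j).aestronglyMeasurable ?_
    refine (ae_restrict_iff' measurableSet_Ioo).2 (Eventually.of_forall fun x hx => ?_)
    rw [Real.norm_of_nonneg (fracLap_off_nonneg hc hΔx h hx)]
    have := fracLap_sum_nonpos hl hc hΔx {i, j} (by simp) hx
    rw [Finset.sum_pair h] at this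
    linarith

lemma Gw_off {clam lam Δx : ℝ} (hc : 0 < clam) (hΔx : 0 < Δx) {i j : ℤ} (hij : i ≠ j) :
    0 ≤ Gw clam lam Δx i j :=
  setIntegral_nonneg measurableSet_Ioo fun _ hx => fracLap_off_nonneg hc hΔx hij hx

lemma Gw_row {clam lam Δx : ℝ} (hl : 0 < lam) (hl1 : lam < 1) (hc : 0 < clam) (hΔx : 0 < Δx)
    (i : ℤ) (F : Finset ℤ) (hF : i ∈ F) : ∑ j ∈ F, Gw clam lam Δx i j ≤ 0 := by
  unfold Gw
  change ∑ j ∈ F, ∫ x in cell Δx i, fracLap clam lam (cellInd Δx j) x ≤ 0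
  rw [← integral_finsetSum F fun j _ => fracLap_int hl hl1 hc hΔx i j]
  exact setIntegral_nonpos measurableSet_Ioo fun _ hx => fracLap_sum_nonpos hl hc hΔx F hF hx

lemma Gw_shift {clam lam Δx : ℝ} (i j k : ℤ) :
    Gw clam lam Δx (i + k) (j + k) = Gw clam lam Δx i j := by
  have h1 : ∀ x, cellInd Δx (j + k) (x + k * Δx) = cellInd Δx j x := by
    intro x
    have : x + k * Δx ∈ cell Δx (j + k) ↔ x ∈ cell Δx j := by
      simp only [cell, mem_Ioo]; push_cast
      constructor <;> rintro ⟨h1, h2⟩ <;> constructor <;> nlinarith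
    by_cases hx : x ∈ cell Δx j
    · rw [cellInd_of_mem hx, cellInd_of_mem (this.2 hx)]
    · rw [cellInd_of_notMem hx, cellInd_of_notMem (fun h => hx (this.1 h))]
  have h2 : ∀ x, fracLap clam lam (cellInd Δx (j + k)) (x + k * Δx) =
      fracLap clam lam (cellInd Δx j) x := by
    intro x
    unfold fracLap
    congr 2
    ext z
    rw [h1, ← h1 (x + z)]
    congr 3; ring
  unfold Gw
  simp_rw [← h2]
  have h3 := (measurePreserving_add_right (volume : Measure ℝ) (k * Δx)).setIntegral_preimage_emb
    (measurableEmbedding_addRight (k * Δx)) (fracLap clam lam (cellInd Δx (j + k)))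
    (Ioo (((i + k : ℤ) : ℝ) * Δx) ((((i + k : ℤ) : ℝ) + 1) * Δx))
  rw [← h3]
  congr 2
  ext x
  simp only [mem_preimage, mem_Ioo]; push_cast
  constructor <;> rintro ⟨h1, h2⟩ <;> constructor <;> nlinarith

lemma Gw_col {clam lam Δx : ℝ} (hl : 0 < lam) (hl1 : lam < 1) (hc : 0 < clam) (hΔx : 0 < Δx)
    (j : ℤ) (F : Finset ℤ) (hF : j ∈ F) : ∑ i ∈ F, Gw clam lam Δx i j ≤ 0 := by
  have h : ∀ i ∈ F, Gw clam lam Δx i j = Gw clam lam Δx j (2 * j - i) := by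
    intro i _
    rw [← Gw_shift i j (j - i)]
    congr 1 <;> ring
  rw [Finset.sum_congr rfl h]
  have inj : Function.Injective (fun i : ℤ => 2 * j - i) := fun a b h => by simpa using h
  have := Gw_row hl hl1 hc hΔx j (F.map ⟨_, inj⟩) (by
    simp only [Finset.mem_map, Function.Embedding.coeFn_mk]
    exact ⟨j, hF, by ring⟩)
  rw [Finset.sum_map] at this
  exact this

lemma prod_sum {k : ℤ → ℤ → ℝ} (hk : ∀ i j, 0 ≤ k i j) {C : ℝ}
    (hs : ∀ j, Summable fun i => k i j) (hC : ∀ j, ∑' i, k i j ≤ C) {E : ℤ → ℝ}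
    (hE0 : ∀ j, 0 ≤ E j) (hE : Summable E) :
    Summable (fun p : ℤ × ℤ => k p.1 p.2 * E p.2) ∧
    ∑' i, ∑' j, k i j * E j ≤ C * ∑' j, E j := by
  have hcol : ∀ j, ∑' i, k i j * E j = (∑' i, k i j) * E j := fun j => tsum_mul_right
  have hle : ∀ j, ∑' i, k i j * E j ≤ C * E j := fun j => by
    rw [hcol]; exact mul_le_mul_of_nonneg_right (hC j) (hE0 j)
  have hS : Summable fun j => ∑' i, k i j * E j :=
    Summable.of_nonneg_of_le (fun j => tsum_nonneg fun i => mul_nonneg (hk i j) (hE0 j)) hle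
      (hE.mul_left C)
  have h1 : Summable (fun p : ℤ × ℤ => k p.2 p.1 * E p.1) := by
    have hnn : 0 ≤ (fun p : ℤ × ℤ => k p.2 p.1 * E p.1) :=
      fun p => mul_nonneg (hk p.2 p.1) (hE0 p.1)
    have hrow : ∀ j, Summable fun i => k i j * E j := fun j => (hs j).mul_right (E j)
    exact (summable_prod_of_nonneg hnn).2 ⟨hrow, hS⟩
  have h2 : Summable (fun p : ℤ × ℤ => k p.1 p.2 * E p.2) := by
    have := (Equiv.prodComm ℤ ℤ).summable_iff.2 h1
    exact this
  refine ⟨h2, ?_⟩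
  have h3 : ∑' i, ∑' j, k i j * E j = ∑' j, ∑' i, k i j * E j :=
    (Summable.tsum_comm (f := fun i j => k i j * E j) h2).symm
  rw [h3, ← tsum_mul_left]
  exact hS.tsum_le_tsum hle (hE.mul_left C)

/-- Off-diagonal part. -/
def off (g : ℤ → ℤ → ℝ) (i j : ℤ) : ℝ := if i = j then 0 else g i j

structure Good (g : ℤ → ℤ → ℝ) (γ : ℝ) : Prop where
  diag : ∀ i, g i i = -γ
  hoff : ∀ i j, i ≠ j → 0 ≤ g i j
  hcol : ∀ (j : ℤ) (F : Finset ℤ), j ∈ F → ∑ i ∈ F, g i j ≤ 0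

lemma Good.nonneg {g : ℤ → ℤ → ℝ} {γ : ℝ} (hg : Good g γ) : 0 ≤ γ := by
  have := hg.hcol 0 {0} (by simp)
  rw [Finset.sum_singleton, hg.diag] at this
  linarith

lemma Good.off_nonneg {g : ℤ → ℤ → ℝ} {γ : ℝ} (hg : Good g γ) (i j : ℤ) : 0 ≤ off g i j := by
  unfold off; split_ifs with h
  · exact le_rfl
  · exact hg.hoff i j h

lemma Good.off_finset {g : ℤ → ℤ → ℝ} {γ : ℝ} (hg : Good g γ) (j : ℤ) (F : Finset ℤ) :
    ∑ i ∈ F, off g i j ≤ γ := by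
  have h1 := hg.hcol j (insert j F) (by simp)
  have h2 : ∑ i ∈ F, off g i j ≤ ∑ i ∈ insert j F, off g i j :=
    Finset.sum_le_sum_of_subset_of_nonneg (by simp) fun i _ _ => hg.off_nonneg i j
  have h3 : ∑ i ∈ insert j F, off g i j = ∑ i ∈ insert j F, (g i j + if i = j then γ else 0) := by
    refine Finset.sum_congr rfl fun i _ => ?_
    unfold off
    split_ifs with h
    · subst h; rw [hg.diag]; ring
    · ring
  rw [h3, Finset.sum_add_distrib, Finset.sum_ite_eq'] at h2
  simp only [Finset.mem_insert_self, if_true] at h2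
  linarith

lemma Good.off_col {g : ℤ → ℤ → ℝ} {γ : ℝ} (hg : Good g γ) (j : ℤ) :
    Summable (fun i => off g i j) ∧ ∑' i, off g i j ≤ γ := by
  have h : Summable (fun i => off g i j) :=
    summable_of_sum_le (fun i => hg.off_nonneg i j) (hg.off_finset j)
  exact ⟨h, h.tsum_le_of_sum_le (hg.off_finset j)⟩

lemma Good.g_prod {g : ℤ → ℤ → ℝ} {γ : ℝ} (hg : Good g γ) {U : ℤ → ℝ} (hU : Summable U) :
    Summable (fun p : ℤ × ℤ => g p.1 p.2 * U p.2) := by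
  have hd : ∀ j : ℤ, HasSum (fun i : ℤ => if i = j then γ else 0) γ := fun j => hasSum_ite_eq j γ
  have habs : ∀ i j, |g i j| = off g i j + if i = j then γ else 0 := by
    intro i j
    unfold off
    split_ifs with h
    · subst h; rw [hg.diag, abs_neg, abs_of_nonneg hg.nonneg]; ring
    · rw [abs_of_nonneg (hg.hoff i j h)]; ring
  have hs : ∀ j, Summable fun i => |g i j| := by
    intro j; simp_rw [habs]; exact (hg.off_col j).1.add (hd j).summable
  have := (prod_sum (k := fun i j => |g i j|) (C := 2 * γ) (fun i j => abs_nonneg _) hs (fun j => by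
    simp_rw [habs]; rw [(hg.off_col j).1.tsum_add (hd j).summable, (hd j).tsum_eq]
    linarith [(hg.off_col j).2]) (E := fun j => |U j|) (fun j => abs_nonneg _) hU.abs).1
  refine Summable.of_norm ?_
  simpa only [Real.norm_eq_abs, abs_mul] using this

lemma slope {φ : ℝ → ℝ} {M : ℝ} (hM : 0 ≤ M) (hm : Monotone φ)
    (hL : ∀ u v, |φ u - φ v| ≤ M * |u - v|) (u v : ℝ) :
    ∃ p, 0 ≤ p ∧ p ≤ M ∧ φ u - φ v = p * (u - v) := by
  by_cases h : u = v
  · exact ⟨0, le_rfl, hM, by subst h; simp⟩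
  · have h0 : u - v ≠ 0 := sub_ne_zero.2 h
    refine ⟨(φ u - φ v) / (u - v), ?_, ?_, by field_simp⟩
    · rcases lt_or_gt_of_ne h with h | h
      · exact div_nonneg_of_nonpos (by linarith [hm h.le]) (by linarith)
      · exact div_nonneg (by linarith [hm h.le]) (by linarith)
    · refine (le_abs_self _).trans ?_
      rw [abs_div, div_le_iff₀ (abs_pos.2 h0)]
      exact hL u v

/-- abstract explicit step -/
noncomputable def step (r s t : ℝ) (F : ℝ → ℝ → ℝ) (A : ℝ → ℝ) (g : ℤ → ℤ → ℝ) (U : ℤ → ℝ)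
    (i : ℤ) : ℝ :=
  U i - r * (F (U i) (U (i + 1)) - F (U (i - 1)) (U i))
    + s * (A (U (i + 1)) - 2 * A (U i) + A (U (i - 1))) + t * ∑' j : ℤ, g i j * U j

set_option maxHeartbeats 2000000 in
lemma contraction {r s t γ M1 M2 Ma : ℝ} {F : ℝ → ℝ → ℝ} {A : ℝ → ℝ} {g : ℤ → ℤ → ℝ}
    (hg : Good g γ) (hr : 0 ≤ r) (hs : 0 ≤ s) (ht : 0 ≤ t)
    (hF1 : ∀ w u v, ∃ p, 0 ≤ p ∧ p ≤ M1 ∧ F u w - F v w = p * (u - v))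
    (hF2 : ∀ w u v, ∃ p, 0 ≤ p ∧ p ≤ M2 ∧ F w u - F w v = - p * (u - v))
    (hA : ∀ u v, ∃ p, 0 ≤ p ∧ p ≤ Ma ∧ A u - A v = p * (u - v))
    (hcfl : r * (M1 + M2) + 2 * s * Ma + t * γ ≤ 1)
    {U V : ℤ → ℝ} (hU : Summable U) (hV : Summable V) :
    Summable (fun i => |step r s t F A g U i - step r s t F A g V i|) ∧
    ∑' i, |step r s t F A g U i - step r s t F A g V i| ≤ ∑' i, |U i - V i| := by
  choose p hp0 hpM hp using hF1
  choose q hq0 hqM hq using hF2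
  choose α hα0 hαM hα using hA
  set D : ℤ → ℝ := fun i => U i - V i with hD
  set E : ℤ → ℝ := fun i => |D i| with hE
  have hDs : Summable D := hU.sub hV
  have hEs : Summable E := hDs.abs
  have hE0 : ∀ i, 0 ≤ E i := fun i => abs_nonneg _
  set pp : ℤ → ℝ := fun i => p (U (i + 1)) (U i) (V i) with hpp
  set qq : ℤ → ℝ := fun i => q (V (i - 1)) (U i) (V i) with hqq
  set aa : ℤ → ℝ := fun i => α (U i) (V i) with haa
  set cP : ℤ → ℝ := fun i => r * pp i + s * aa i with hcP
  set cQ : ℤ → ℝ := fun i => r * qq i + s * aa i with hcQ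
  have hcP0 : ∀ i, 0 ≤ cP i := fun i =>
    add_nonneg (mul_nonneg hr (hp0 _ _ _)) (mul_nonneg hs (hα0 _ _))
  have hcQ0 : ∀ i, 0 ≤ cQ i := fun i =>
    add_nonneg (mul_nonneg hr (hq0 _ _ _)) (mul_nonneg hs (hα0 _ _))
  have hγ := hg.nonneg
  have hco : ∀ i, 0 ≤ 1 - cP i - cQ i - t * γ := by
    intro i
    have h1 : r * pp i ≤ r * M1 := mul_le_mul_of_nonneg_left (hpM _ _ _) hr
    have h2 : r * qq i ≤ r * M2 := mul_le_mul_of_nonneg_left (hqM _ _ _) hr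
    have h3 : s * aa i ≤ s * Ma := mul_le_mul_of_nonneg_left (hαM _ _) hs
    simp only [hcP, hcQ]
    nlinarith
  have htγ : 0 ≤ t * γ := mul_nonneg ht hγ
  have hcP1 : ∀ i, cP i ≤ 1 := fun i => by linarith [hco i, hcQ0 i]
  have hcQ1 : ∀ i, cQ i ≤ 1 := fun i => by linarith [hco i, hcP0 i]
  obtain ⟨hprod, hTle⟩ := prod_sum hg.off_nonneg (fun j => (hg.off_col j).1)
    (fun j => (hg.off_col j).2) hE0 hEs
  set T : ℤ → ℝ := fun i => ∑' j, off g i j * E j with hT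
  have hTs : Summable T := hprod.prod
  have hPs : Summable (fun i => cP i * E i) :=
    Summable.of_nonneg_of_le (fun i => mul_nonneg (hcP0 i) (hE0 i))
      (fun i => mul_le_of_le_one_left (hE0 i) (hcP1 i)) hEs
  have hQs : Summable (fun i => cQ i * E i) :=
    Summable.of_nonneg_of_le (fun i => mul_nonneg (hcQ0 i) (hE0 i))
      (fun i => mul_le_of_le_one_left (hE0 i) (hcQ1 i)) hEs
  have hPs' : Summable (fun i => cP (i - 1) * E (i - 1)) :=
    (Equiv.subRight (1:ℤ)).summable_iff.2 hPs
  have hQs' : Summable (fun i => cQ (i + 1) * E (i + 1)) :=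
    (Equiv.addRight (1:ℤ)).summable_iff.2 hQs
  have hP' : ∑' i, cP (i - 1) * E (i - 1) = ∑' i, cP i * E i :=
    (Equiv.subRight (1:ℤ)).tsum_eq (fun i => cP i * E i)
  have hQ' : ∑' i, cQ (i + 1) * E (i + 1) = ∑' i, cQ i * E i :=
    (Equiv.addRight (1:ℤ)).tsum_eq (fun i => cQ i * E i)
  set B : ℤ → ℝ := fun i => E i - cP i * E i - cQ i * E i - t * γ * E i
    + cQ (i + 1) * E (i + 1) + cP (i - 1) * E (i - 1) + t * T i with hB
  have hBs : HasSum B (∑' i, E i - ∑' i, cP i * E i - ∑' i, cQ i * E i - t * γ * ∑' i, E i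
      + ∑' i, cQ i * E i + ∑' i, cP i * E i + t * ∑' i, T i) := by
    have := (((((hEs.hasSum.sub hPs.hasSum).sub hQs.hasSum).sub
      (hEs.hasSum.mul_left (t * γ))).add hQs'.hasSum).add hPs'.hasSum).add (hTs.hasSum.mul_left t)
    rw [hP', hQ'] at this
    exact this
  have hgD : ∀ W : ℤ → ℝ, Summable W → ∀ i, Summable (fun j => g i j * W j) :=
    fun W hW i => (hg.g_prod hW).prod_factor i
  have hkey : ∀ i, |step r s t F A g U i - step r s t F A g V i| ≤ B i := by
    intro i
    have e1 : ∑' j, g i j * U j - ∑' j, g i j * V j = ∑' j, off g i j * D j - γ * D i := by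
      have hd : HasSum (fun j => if j = i then γ * D i else 0) (γ * D i) := hasSum_ite_eq i _
      have ho : (fun j => off g i j * D j) =
          fun j => (g i j * U j - g i j * V j) + if j = i then γ * D i else 0 := by
        ext j
        unfold off
        by_cases h : i = j
        · subst h; simp [hg.diag, hD]; ring
        · rw [if_neg h, if_neg (Ne.symm h)]; simp only [hD]; ring
      rw [ho, ((hgD U hU i).sub (hgD V hV i)).tsum_add hd.summable, hd.tsum_eq,
        (hgD U hU i).tsum_sub (hgD V hV i)]
      ring
    have hoS : Summable (fun j => |off g i j * D j|) := by
      have := hprod.prod_factor i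
      refine this.congr fun j => ?_
      rw [abs_mul, abs_of_nonneg (hg.off_nonneg i j)]
    have e2 : |∑' j, off g i j * D j| ≤ T i := by
      have := norm_tsum_le_tsum_norm (f := fun j => off g i j * D j) hoS
      simp only [Real.norm_eq_abs] at this
      refine this.trans (le_of_eq (tsum_congr fun j => ?_))
      rw [abs_mul, abs_of_nonneg (hg.off_nonneg i j)]
    set R := ∑' j, off g i j * D j
    have f1 : F (U i) (U (i + 1)) - F (V i) (V (i + 1)) = pp i * D i - qq (i + 1) * D (i + 1) := by
      have h1 := hp (U (i + 1)) (U i) (V i)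
      have h2 := hq (V i) (U (i + 1)) (V (i + 1))
      simp only [hpp, hqq, hD, add_sub_cancel_right]
      linarith
    have f2 : F (U (i - 1)) (U i) - F (V (i - 1)) (V i) = pp (i - 1) * D (i - 1) - qq i * D i := by
      have h1 := hp (U i) (U (i - 1)) (V (i - 1))
      have h2 := hq (V (i - 1)) (U i) (V i)
      simp only [hpp, hqq, hD, sub_add_cancel]
      linarith
    have a0 : A (U i) - A (V i) = aa i * D i := hα _ _
    have a1 : A (U (i + 1)) - A (V (i + 1)) = aa (i + 1) * D (i + 1) := hα _ _
    have a2 : A (U (i - 1)) - A (V (i - 1)) = aa (i - 1) * D (i - 1) := hα _ _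
    have main : step r s t F A g U i - step r s t F A g V i =
        (1 - cP i - cQ i - t * γ) * D i + cQ (i + 1) * D (i + 1) + cP (i - 1) * D (i - 1)
          + t * R := by
      unfold step
      have hDi : U i - V i = D i := rfl
      simp only [hcP, hcQ]
      linear_combination hDi - r * f1 + r * f2 + s * a1 - 2 * s * a0 + s * a2 + t * e1
    rw [main]
    refine (abs_add_le _ _).trans ?_
    refine (add_le_add_left (abs_add_le _ _) _).trans ?_
    refine (add_le_add_left (add_le_add_left (abs_add_le _ _) _) _).trans ?_
    rw [abs_mul, abs_mul, abs_mul, abs_mul, abs_of_nonneg (hco i), abs_of_nonneg (hcQ0 _),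
      abs_of_nonneg (hcP0 _), abs_of_nonneg ht]
    have := mul_le_mul_of_nonneg_left e2 ht
    simp only [hB, hE]
    linarith
  have hsum := Summable.of_nonneg_of_le (fun i => abs_nonneg _) hkey hBs.summable
  refine ⟨hsum, (hsum.tsum_le_tsum hkey hBs.summable).trans ?_⟩
  rw [hBs.tsum_eq]
  have := mul_le_mul_of_nonneg_left hTle ht
  linarith

lemma Gw_good {clam lam Δx : ℝ} (hl : 0 < lam) (hl1 : lam < 1) (hc : 0 < clam) (hΔx : 0 < Δx) :
    Good (Gw clam lam Δx) (dlam clam lam * Δx ^ (1 - lam)) where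
  diag i := (diag_int hl hl1 hΔx i).2
  hoff _ _ h := Gw_off hc hΔx h
  hcol j F h := Gw_col hl hl1 hc hΔx j F h

lemma W_diff {clam lam Δx b : ℝ} {fhat : ℝ → ℝ → ℝ} {a : ℝ → ℝ} {γ : ℝ}
    (hg : Good (Gw clam lam Δx) γ) {U : ℤ → ℝ} (hU : Summable U) {Δt : ℝ} (hΔx : 0 < Δx)
    (hΔt : 0 < Δt) (i : ℤ) :
    Wq clam lam Δx b fhat a U (i + 1) - Wq clam lam Δx b fhat a U i =
      (Δx / Δt) * (U (i + 1) - schemeStep clam lam Δx Δt b fhat a U (i + 1)) := by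
  have hp := hg.g_prod hU
  set R : ℤ → ℝ := fun k => ∑' j, Gw clam lam Δx k j * U j with hR
  have hRs : Summable R := hp.prod
  have h1 : ∀ i : ℤ, ∑' p : {k : ℤ // k ≤ i} × ℤ, Gw clam lam Δx p.1.val p.2 * U p.2 =
      ∑' k, indicator (Iic i) R k := by
    intro i
    have inj : Function.Injective (fun p : {k : ℤ // k ≤ i} × ℤ => ((p.1 : ℤ), p.2)) := by
      rintro ⟨⟨x, hx⟩, y⟩ ⟨⟨x2, hx2⟩, y2⟩ h
      simpa using h
    have hs : Summable (fun p : {k : ℤ // k ≤ i} × ℤ => Gw clam lam Δx p.1.val p.2 * U p.2) := by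
      have h := Summable.comp_injective (f := fun p : ℤ × ℤ => Gw clam lam Δx p.1 p.2 * U p.2) hp inj
      simpa only [Function.comp_def] using h
    rw [hs.tsum_prod]
    exact tsum_subtype (Iic i) R
  have h2 : ∑' k, indicator (Iic (i + 1)) R k = ∑' k, indicator (Iic i) R k + R (i + 1) := by
    have hd : HasSum (fun k => if k = i + 1 then R (i + 1) else 0) (R (i + 1)) :=
      hasSum_ite_eq (i + 1) _
    have : (indicator (Iic (i + 1)) R) =
        fun k => indicator (Iic i) R k + if k = i + 1 then R (i + 1) else 0 := by
      ext k
      simp only [indicator, mem_Iic]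
      rcases lt_trichotomy k (i + 1) with h | h | h
      · rw [if_pos h.le, if_pos (by omega), if_neg (by omega)]; ring
      · subst h; simp
      · rw [if_neg (by omega), if_neg (by omega), if_neg (by omega)]; ring
    rw [this, (hRs.indicator _).tsum_add hd.summable, hd.tsum_eq]
  unfold Wq schemeStep
  rw [h1, h1, h2]
  simp only [add_sub_cancel_right]
  change _ = (Δx / Δt) * (_ - (_ + _ * R (i + 1)))
  field_simp
  ring

lemma Aint_slope {a : ℝ → ℝ} {Ma : ℝ} (hc : Continuous a) (h0 : ∀ s, 0 ≤ a s)
    (hM : ∀ s, |a s| ≤ Ma) (u v : ℝ) :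
    ∃ p, 0 ≤ p ∧ p ≤ Ma ∧ Aint a u - Aint a v = p * (u - v) := by
  have hd : ∀ u, HasDerivAt (Aint a) (a u) u := fun u =>
    intervalIntegral.integral_hasDerivAt_right (hc.intervalIntegrable _ _)
      (hc.stronglyMeasurableAtFilter _ _) hc.continuousAt
  refine slope ((abs_nonneg _).trans (hM 0)) ?_ ?_ u v
  · refine monotone_of_deriv_nonneg (fun u => (hd u).differentiableAt) fun u => ?_
    rw [(hd u).deriv]; exact h0 u
  · intro u v
    exact Convex.norm_image_sub_le_of_norm_deriv_le (s := univ) (fun u _ => (hd u).differentiableAt)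
      (fun u _ => by rw [(hd u).deriv]; exact hM u) convex_univ (mem_univ v) (mem_univ u)

lemma U0_summable {Δx : ℝ} (hΔx : 0 < Δx) {u₀ : ℝ → ℝ} (h : Integrable u₀) :
    Summable fun i : ℤ =>
      (1 / Δx) * ∫ x in Set.Ioo ((i : ℝ) * Δx) (((i : ℝ) + 1) * Δx), u₀ x := by
  refine Summable.mul_left _ ?_
  refine (hasSum_integral_iUnion (s := cell Δx) (fun i => measurableSet_Ioo) ?_ h.integrableOn).summable
  intro i j hij
  exact Set.disjoint_left.2 fun x hx => cell_disj hΔx hij hx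

end WBV


open WBV in
/-- Under the CFL condition the total variation of `W^n` is nonincreasing in `n`:
`Σ_i |W_{i+1}^n − W_i^n| ≤ Σ_i |W_{i+1}^0 − W_i^0|`. -/
theorem W_BV_stability (lam : ℝ) (hlam : lam ∈ Set.Ioo (0 : ℝ) 1)
    (clam : ℝ) (hclam : 0 < clam) (Δx Δt : ℝ) (hΔx : 0 < Δx) (hΔt : 0 < Δt)
    (b : ℝ) (hb : 0 ≤ b) (f a : ℝ → ℝ) (fhat : ℝ → ℝ → ℝ)
    (hdata : SchemeData f a fhat) (hfC1 : ContDiff ℝ 1 f)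
    (u₀ : ℝ → ℝ) (hu₀1 : Integrable u₀) (hu₀bv : eVariationOn u₀ Set.univ ≠ ⊤)
    (hcfl : CFL clam lam Δx Δt b fhat a) :
    ∀ n : ℕ,
      ∑' i : ℤ, (‖Wq clam lam Δx b fhat a (Uiter clam lam Δx Δt b fhat a u₀ n) (i + 1) -
          Wq clam lam Δx b fhat a (Uiter clam lam Δx Δt b fhat a u₀ n) i‖₊ : ENNReal) ≤
      ∑' i : ℤ, (‖Wq clam lam Δx b fhat a (Uiter clam lam Δx Δt b fhat a u₀ 0) (i + 1) -
          Wq clam lam Δx b fhat a (Uiter clam lam Δx Δt b fhat a u₀ 0) i‖₊ : ENNReal) := by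
  obtain ⟨hl, hl1⟩ := hlam
  obtain ⟨hC1, M1, M2, Ma, hM1, hM2, hMa, hle⟩ := hcfl
  have hg := Gw_good hl hl1 hclam hΔx
  set γ := dlam clam lam * Δx ^ (1 - lam) with hγ
  obtain ⟨Ka, hKa⟩ := hdata.haLip
  have hd1 : ∀ w, Differentiable ℝ (fun s => fhat s w) := fun w =>
    (hC1.differentiable (by norm_num)).comp (differentiable_id.prodMk (differentiable_const w))
  have hd2 : ∀ w, Differentiable ℝ (fun s => fhat w s) := fun w =>
    (hC1.differentiable (by norm_num)).comp ((differentiable_const w).prodMk differentiable_id)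
  have hF1 : ∀ w u v, ∃ p, 0 ≤ p ∧ p ≤ M1 ∧ fhat u w - fhat v w = p * (u - v) := by
    intro w u v
    refine slope (φ := fun s => fhat s w) ((abs_nonneg _).trans (hM1 0 0)) (hdata.hmono1 w) ?_ u v
    intro u v
    exact Convex.norm_image_sub_le_of_norm_deriv_le (f := fun s => fhat s w) (s := univ)
      (fun u _ => (hd1 w) u) (fun u _ => hM1 u w) convex_univ (mem_univ v) (mem_univ u)
  have hF2 : ∀ w u v, ∃ p, 0 ≤ p ∧ p ≤ M2 ∧ fhat w u - fhat w v = - p * (u - v) := by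
    intro w u v
    obtain ⟨p, h0, h1, h2⟩ := slope (φ := fun s => - fhat w s) (M := M2)
      ((abs_nonneg _).trans (hM2 0 0)) (fun x y h => neg_le_neg (hdata.hmono2 w h)) (by
        intro u v
        have := Convex.norm_image_sub_le_of_norm_deriv_le (f := fun s => fhat w s) (s := univ)
          (fun u _ => (hd2 w) u) (fun u _ => hM2 w u) convex_univ (mem_univ u) (mem_univ v)
        simp only [Real.norm_eq_abs] at this
        rw [neg_sub_neg, abs_sub_comm u v]
        exact this) u v
    exact ⟨p, h0, h1, by linarith⟩
  have hA := Aint_slope hKa.continuous hdata.haNonneg hMa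
  have hcfl' : (Δt / Δx) * (M1 + M2) + 2 * (Δt / Δx ^ 2) * Ma + (b * Δt / Δx) * γ ≤ 1 := by
    refine le_trans (le_of_eq ?_) hle
    rw [hγ, Real.rpow_sub hΔx, Real.rpow_one]
    have : Δx ^ lam ≠ 0 := (Real.rpow_pos_of_pos hΔx _).ne'
    field_simp
  have hcon := fun (U V : ℤ → ℝ) (hU : Summable U) (hV : Summable V) =>
    contraction hg (div_nonneg hΔt.le hΔx.le) (div_nonneg hΔt.le (sq_nonneg Δx))
      (div_nonneg (mul_nonneg hb hΔt.le) hΔx.le) hF1 hF2 hA hcfl' hU hV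
  have hstep : ∀ U, step (Δt / Δx) (Δt / Δx ^ 2) (b * Δt / Δx) fhat (Aint a) (Gw clam lam Δx) U =
      schemeStep clam lam Δx Δt b fhat a U := fun U => rfl
  simp only [hstep] at hcon
  set Un := Uiter clam lam Δx Δt b fhat a u₀ with hUn
  have hsucc : ∀ n, Un (n + 1) = schemeStep clam lam Δx Δt b fhat a (Un n) := fun n => rfl
  have hS0 : ∀ i, schemeStep clam lam Δx Δt b fhat a (fun _ => 0) i = 0 := by
    intro i; simp [schemeStep, Aint]
  have hsum : ∀ n, Summable (Un n) := by
    intro n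
    induction n with
    | zero => exact U0_summable hΔx hu₀1
    | succ n ih =>
      have := (hcon (Un n) (fun _ => 0) ih summable_zero).1
      simp only [hS0, sub_zero] at this
      rw [hsucc]
      exact this.of_abs
  have hdiff : ∀ n, Summable (fun i => |Un n i - Un (n + 1) i|) := fun n =>
    ((hsum n).sub (hsum (n + 1))).abs
  have hTV : ∀ n, ∑' i : ℤ, (‖Wq clam lam Δx b fhat a (Un n) (i + 1) -
      Wq clam lam Δx b fhat a (Un n) i‖₊ : ENNReal) =
      ENNReal.ofReal (∑' i, Δx / Δt * |Un n i - Un (n + 1) i|) := by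
    intro n
    have h1 : ∀ i : ℤ, (‖Wq clam lam Δx b fhat a (Un n) (i + 1) -
        Wq clam lam Δx b fhat a (Un n) i‖₊ : ENNReal) =
        ENNReal.ofReal (Δx / Δt * |Un n (i + 1) - Un (n + 1) (i + 1)|) := by
      intro i
      rw [W_diff hg (hsum n) hΔx hΔt, ← hsucc, ← enorm_eq_nnnorm, Real.enorm_eq_ofReal_abs, abs_mul,
        abs_of_pos (div_pos hΔx hΔt)]
    rw [tsum_congr h1, ENNReal.ofReal_tsum_of_nonneg
      (fun i => mul_nonneg (div_pos hΔx hΔt).le (abs_nonneg _)) ((hdiff n).mul_left _)]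
    exact (Equiv.addRight (1:ℤ)).tsum_eq
      (fun i => ENNReal.ofReal (Δx / Δt * |Un n i - Un (n + 1) i|))
  intro n
  rw [hTV, hTV]
  refine ENNReal.ofReal_le_ofReal ?_
  rw [tsum_mul_left, tsum_mul_left]
  refine mul_le_mul_of_nonneg_left ?_ (div_pos hΔx hΔt).le
  induction n with
  | zero => exact le_rfl
  | succ n ih => exact (hcon (Un n) (Un (n + 1)) (hsum n) (hsum (n + 1))).2.trans ih
end

section
/- Assume u₀ ∈ L¹(ℝ) ∩ BV(ℝ), that f is continuously differentiable, and that the CFL condition holds. Then for all integers m, n ≥ 0, Σ_{i∈ℤ} |U_i^m − U_i^n| ≤ ( Σ_{i∈ℤ} |W_{i+1}^0 − W_i^0| ) (Δt/Δx) |m − n|. -/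
open MeasureTheory Filter Set

/-- odd power -/
noncomputable def psi (lam t : ℝ) : ℝ := if 0 < t then t ^ (-lam) else - (-t) ^ (-lam)

noncomputable def stepf (s : ℝ) : ℝ → ℝ := Set.indicator (Set.Ioi s) 1

lemma step_int (lam : ℝ) (hlam : lam ∈ Set.Ioo (0 : ℝ) 1) (s x : ℝ) (hsx : s ≠ x) :
    Integrable (fun z => (stepf s (x + z) - stepf s x) / |z| ^ (1 + lam)) ∧
    ∫ z, (stepf s (x + z) - stepf s x) / |z| ^ (1 + lam) = psi lam (s - x) / lam := by
  obtain ⟨h0, h1⟩ := hlam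
  rcases lt_or_gt_of_ne hsx with h | h
  · -- s < x
    have key : (fun z => (stepf s (x + z) - stepf s x) / |z| ^ (1 + lam)) =
        fun z => (Set.Ici (x - s)).indicator (fun w : ℝ => - w ^ (-(1 + lam))) (-z) := by
      funext z
      by_cases hz : s < x + z
      · have : ¬ (x - s ≤ -z) := by linarith
        simp [stepf, Set.indicator, hz, h, this]
      · have h2 : (x - s ≤ -z) := by linarith
        have h3 : z < 0 := by linarith
        simp only [stepf, Set.indicator, Set.mem_Ioi, hz, h, Set.mem_Ici, h2, if_true, if_false]
        rw [Real.rpow_neg (by linarith), abs_of_neg h3]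
        simp [div_eq_mul_inv]
    have hi : IntegrableOn (fun w : ℝ => - w ^ (-(1 + lam))) (Set.Ici (x - s)) := by
      rw [integrableOn_Ici_iff_integrableOn_Ioi]
      exact (integrableOn_Ioi_rpow_of_lt (by linarith) (by linarith)).neg
    rw [key]
    refine ⟨((integrable_indicator_iff measurableSet_Ici).2 hi).comp_neg, ?_⟩
    rw [integral_neg_eq_self (fun z => (Set.Ici (x - s)).indicator (fun w : ℝ => - w ^ (-(1 + lam))) z),
      integral_indicator measurableSet_Ici, integral_Ici_eq_integral_Ioi, integral_neg,
      integral_Ioi_rpow_of_lt (by linarith) (by linarith), psi, if_neg (by linarith)]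
    have : -(1 + lam) + 1 = -lam := by ring
    rw [this]
    simp [div_neg]
  · -- x < s
    have key : (fun z => (stepf s (x + z) - stepf s x) / |z| ^ (1 + lam)) =
        fun z => (Set.Ioi (s - x)).indicator (fun w : ℝ => w ^ (-(1 + lam))) z := by
      funext z
      by_cases hz : s < x + z
      · have h2 : (s - x < z) := by linarith
        have h3 : 0 < z := by linarith
        simp only [stepf, Set.indicator, Set.mem_Ioi, hz, h.not_gt, h2, if_true, if_false]
        rw [Real.rpow_neg (by linarith), abs_of_pos h3]
        simp [div_eq_mul_inv]
      · have : ¬ (s - x < z) := by linarith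
        simp [stepf, Set.indicator, hz, h.not_gt, this]
    have hi : IntegrableOn (fun w : ℝ => w ^ (-(1 + lam))) (Set.Ioi (s - x)) :=
      (integrableOn_Ioi_rpow_of_lt (by linarith) (by linarith))
    rw [key]
    refine ⟨((integrable_indicator_iff measurableSet_Ioi).2 hi), ?_⟩
    rw [integral_indicator measurableSet_Ioi, 
      integral_Ioi_rpow_of_lt (by linarith) (by linarith), psi, if_pos (by linarith)]
    have : -(1 + lam) + 1 = -lam := by ring
    rw [this]
    ring

lemma fracLap_cell (clam lam : ℝ) (hlam : lam ∈ Set.Ioo (0 : ℝ) 1) (Δx : ℝ) (hΔx : 0 < Δx)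
    (j : ℤ) (x : ℝ) (h1 : (j : ℝ) * Δx ≠ x) (h2 : ((j : ℝ) + 1) * Δx ≠ x) :
    fracLap clam lam (cellInd Δx j) x =
      clam / lam * (psi lam (j * Δx - x) - psi lam ((j + 1) * Δx - x)) := by
  have hcell : ∀ y, y ≠ ((j : ℝ) + 1) * Δx → cellInd Δx j y =
      stepf (j * Δx) y - stepf ((j + 1) * Δx) y := by
    intro y hy
    have : (j : ℝ) * Δx < (j + 1) * Δx := by nlinarith
    simp only [cellInd, stepf, Set.indicator, Set.mem_Ioo, Set.mem_Ioi, Pi.one_apply]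
    rcases lt_or_gt_of_ne hy with h | h
    · by_cases h' : (j : ℝ) * Δx < y <;> simp [h, h.not_gt, h']
    · simp [h, h.not_gt, this.trans h]
  have hrestr : (volume.restrict ({0}ᶜ : Set ℝ)) = volume := by
    rw [Measure.restrict_eq_self_of_ae_mem]
    simp [ae_iff]
  obtain ⟨i1, e1⟩ := step_int lam hlam _ x h1
  obtain ⟨i2, e2⟩ := step_int lam hlam _ x h2
  unfold fracLap
  rw [hrestr]
  have : ∫ z, (cellInd Δx j (x + z) - cellInd Δx j x) / |z| ^ (1 + lam) =
      ∫ z, ((stepf (j * Δx) (x + z) - stepf (j * Δx) x) / |z| ^ (1 + lam) -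
       (stepf ((j + 1) * Δx) (x + z) - stepf ((j + 1) * Δx) x) / |z| ^ (1 + lam)) := by
    apply integral_congr_ae
    have : ∀ᵐ z : ℝ, z ≠ ((j : ℝ) + 1) * Δx - x := by simp [ae_iff]
    filter_upwards [this] with z hz
    rw [hcell _ h2.symm, hcell _ (by intro h; apply hz; linarith)]
    ring
  rw [this, integral_sub i1 i2, e1, e2]
  ring

lemma psi_int (lam : ℝ) (hlam : lam ∈ Set.Ioo (0 : ℝ) 1) (s p q : ℝ) (hpq : p < q)
    (h : s ≤ p ∨ q ≤ s) :
    IntegrableOn (fun x => psi lam (s - x)) (Set.Ioo p q) ∧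
    ∫ x in Set.Ioo p q, psi lam (s - x) =
      (|s - p| ^ (1 - lam) - |s - q| ^ (1 - lam)) / (1 - lam) := by
  obtain ⟨h0, h1⟩ := hlam
  have hne : (-lam + 1) = 1 - lam := by ring
  rcases h with h | h
  · have e : EqOn (fun x => psi lam (s - x)) (fun x => - (x - s) ^ (-lam)) (Set.Ioo p q) := by
      intro x hx
      have := hx.1
      simp only [psi]
      rw [if_neg (by linarith)]; simp
    have ii : IntervalIntegrable (fun x : ℝ => - (x - s) ^ (-lam)) volume p q := by
      have := (intervalIntegral.intervalIntegrable_rpow' (r := -lam) (by linarith) (a := p - s) (b := q - s)).comp_sub_right s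
      have := this.neg; simp only [sub_add_cancel] at this; exact this
    constructor
    · rw [integrableOn_congr_fun e measurableSet_Ioo]
      exact ((intervalIntegrable_iff_integrableOn_Ioo_of_le hpq.le).1 ii)
    · rw [setIntegral_congr_fun measurableSet_Ioo e, ← integral_Ioc_eq_integral_Ioo,
        ← intervalIntegral.integral_of_le hpq.le, intervalIntegral.integral_neg,
        intervalIntegral.integral_comp_sub_right (fun x => x ^ (-lam)),
        integral_rpow (Or.inl (by linarith)), hne, abs_of_nonpos (by linarith),
        abs_of_nonpos (by linarith)]
      simp only [neg_sub]; ring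
  · have e : EqOn (fun x => psi lam (s - x)) (fun x => (s - x) ^ (-lam)) (Set.Ioo p q) := by
      intro x hx
      have := hx.2
      simp only [psi]
      rw [if_pos (by linarith)]
    have ii : IntervalIntegrable (fun x : ℝ => (s - x) ^ (-lam)) volume p q := by
      have := (intervalIntegral.intervalIntegrable_rpow' (r := -lam) (by linarith) (a := s - p) (b := s - q)).comp_sub_left s
      simpa using this
    constructor
    · rw [integrableOn_congr_fun e measurableSet_Ioo]
      exact ((intervalIntegrable_iff_integrableOn_Ioo_of_le hpq.le).1 ii)
    · rw [setIntegral_congr_fun measurableSet_Ioo e, ← integral_Ioc_eq_integral_Ioo,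
        ← intervalIntegral.integral_of_le hpq.le, 
        intervalIntegral.integral_comp_sub_left (fun x => x ^ (-lam)),
        integral_rpow (Or.inl (by linarith)), hne, abs_of_nonneg (by linarith),
        abs_of_nonneg (by linarith)]

noncomputable def Fp (lam Δx : ℝ) (n : ℤ) : ℝ := |(n : ℝ) * Δx| ^ (1 - lam)

noncomputable def gk (clam lam Δx : ℝ) (n : ℤ) : ℝ :=
  clam / lam / (1 - lam) * (2 * Fp lam Δx n - Fp lam Δx (n - 1) - Fp lam Δx (n + 1))

lemma Gw_eq (clam lam : ℝ) (hlam : lam ∈ Set.Ioo (0 : ℝ) 1) (Δx : ℝ) (hΔx : 0 < Δx)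
    (i j : ℤ) : Gw clam lam Δx i j = gk clam lam Δx (j - i) := by
  have hpq : (i : ℝ) * Δx < (i + 1) * Δx := by nlinarith
  have hor : ∀ k : ℤ, (k : ℝ) * Δx ≤ i * Δx ∨ ((i : ℝ) + 1) * Δx ≤ k * Δx := by
    intro k
    rcases le_or_gt k i with h | h
    · left; gcongr
    · right; gcongr; exact_mod_cast h
  have hne : ∀ k : ℤ, ∀ x ∈ Set.Ioo ((i : ℝ) * Δx) ((i + 1) * Δx), (k : ℝ) * Δx ≠ x := by
    rintro k x ⟨hx1, hx2⟩ rfl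
    rcases hor k with h | h <;> linarith
  obtain ⟨i1, e1⟩ := psi_int lam hlam _ _ _ hpq (hor j)
  obtain ⟨i2, e2⟩ := psi_int lam hlam _ _ _ hpq (hor (j + 1))
  push_cast at i2 e2
  unfold Gw
  rw [setIntegral_congr_fun (g := fun x => clam / lam * (psi lam (j * Δx - x) - psi lam ((j + 1) * Δx - x))) measurableSet_Ioo
    (fun x hx => fracLap_cell clam lam hlam Δx hΔx j x (hne j x hx)
      (by have := hne (j + 1) x hx; push_cast at this; exact this)),
    integral_const_mul, integral_sub i1 i2, e1, e2]
  have a1 : (j : ℝ) * Δx - i * Δx = (j - i) * Δx := by ring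
  have a2 : (j : ℝ) * Δx - (i + 1) * Δx = (j - i - 1) * Δx := by ring
  have a3 : (j + 1 : ℝ) * Δx - i * Δx = (j - i + 1) * Δx := by ring
  have a4 : (j + 1 : ℝ) * Δx - (i + 1) * Δx = (j - i) * Δx := by ring
  rw [a1, a2, a3, a4]
  simp only [gk, Fp]
  push_cast
  ring

lemma gk_nonneg (clam lam : ℝ) (hclam : 0 < clam) (hlam : lam ∈ Set.Ioo (0 : ℝ) 1) (Δx : ℝ) (hΔx : 0 < Δx)
    (n : ℤ) (hn : n ≠ 0) : 0 ≤ gk clam lam Δx n := by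
  have := Gw_eq clam lam hlam Δx hΔx 0 n
  rw [sub_zero] at this
  rw [← this]
  unfold Gw
  apply setIntegral_nonneg measurableSet_Ioo
  intro x hx
  have hx0 : cellInd Δx n x = 0 := by
    unfold cellInd
    apply Set.indicator_of_notMem
    rintro ⟨h1, h2⟩
    obtain ⟨h3, h4⟩ := hx
    push_cast at h3 h4
    have e1 : (n : ℝ) < 0 + 1 := lt_of_mul_lt_mul_right (h1.trans h4) hΔx.le
    have e2 : (0 : ℝ) < n + 1 := lt_of_mul_lt_mul_right (h3.trans h2) hΔx.le
    have e1' : n < 0 + 1 := by exact_mod_cast e1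
    have e2' : 0 < n + 1 := by exact_mod_cast e2
    omega
  unfold fracLap
  apply mul_nonneg hclam.le
  apply integral_nonneg
  intro z
  simp only [hx0, sub_zero]
  apply div_nonneg
  · unfold cellInd; apply Set.indicator_nonneg; intros; simp
  · positivity

lemma dlam_eq (clam lam : ℝ) (hlam : lam ∈ Set.Ioo (0 : ℝ) 1) :
    dlam clam lam = 2 * (clam / lam / (1 - lam)) := by
  obtain ⟨h0, h1⟩ := hlam
  have e1 : ∫ z in {z : ℝ | |z| < 1}, |z| ^ (-lam) = 2 / (1 - lam) := by
    have hm : MeasurableSet {z : ℝ | |z| < 1} := measurableSet_lt measurable_id.abs measurable_const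
    rw [← integral_indicator hm]
    have : ({z : ℝ | |z| < 1}.indicator fun z => |z| ^ (-lam)) =
      fun z => (Set.Iio 1).indicator (fun w : ℝ => w ^ (-lam)) |z| := by
      funext z; simp [Set.indicator]
    rw [this, integral_comp_abs (f := (Set.Iio 1).indicator (fun w : ℝ => w ^ (-lam))),
      setIntegral_indicator measurableSet_Iio, Set.Ioi_inter_Iio,
      ← integral_Ioc_eq_integral_Ioo,
        ← intervalIntegral.integral_of_le zero_le_one, integral_rpow (Or.inl (by linarith))]
    rw [Real.zero_rpow (by linarith), Real.one_rpow]
    ring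
  have e2 : ∫ z in {z : ℝ | 1 < |z|}, |z| ^ (-1 - lam) = 2 / lam := by
    have hm : MeasurableSet {z : ℝ | 1 < |z|} := measurableSet_lt measurable_const measurable_id.abs
    rw [← integral_indicator hm]
    have : ({z : ℝ | 1 < |z|}.indicator fun z => |z| ^ (-1 - lam)) =
      fun z => (Set.Ioi 1).indicator (fun w : ℝ => w ^ (-1 - lam)) |z| := by
      funext z; simp [Set.indicator]
    rw [this, integral_comp_abs (f := (Set.Ioi 1).indicator (fun w : ℝ => w ^ (-1 - lam))),
      setIntegral_indicator measurableSet_Ioi, Set.Ioi_inter_Ioi, max_eq_right zero_le_one,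
      integral_Ioi_rpow_of_lt (by linarith) one_pos, Real.one_rpow]
    have : -1 - lam + 1 = -lam := by ring
    rw [this, neg_div_neg_eq]; ring
  unfold dlam
  rw [e1, e2]
  have : lam ≠ 0 := h0.ne'
  have : 1 - lam ≠ 0 := by linarith
  field_simp
  ring

lemma gk_zero (clam lam : ℝ) (hlam : lam ∈ Set.Ioo (0 : ℝ) 1) (Δx : ℝ) (hΔx : 0 < Δx) :
    gk clam lam Δx 0 = - (dlam clam lam * Δx / Δx ^ lam) := by
  rw [dlam_eq _ _ hlam]
  have : 1 - lam ≠ 0 := by linarith [hlam.2]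
  simp [gk, Fp, abs_of_pos hΔx, Real.zero_rpow this, Real.rpow_sub hΔx]
  ring

lemma gk_sum (clam lam : ℝ) (hclam : 0 < clam) (hlam : lam ∈ Set.Ioo (0 : ℝ) 1) (Δx : ℝ) (hΔx : 0 < Δx) (N : ℕ) :
    ∑ n ∈ Finset.Icc (-(N : ℤ)) N, gk clam lam Δx n ≤ 0 := by
  have tel : ∑ n ∈ Finset.Icc (-(N : ℤ)) N, gk clam lam Δx n =
      2 * (clam / lam / (1 - lam)) * (Fp lam Δx N - Fp lam Δx (N + 1)) := by
    have ev : ∀ n, Fp lam Δx (-n) = Fp lam Δx n := by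
      intro n; simp [Fp]
    induction N with
    | zero => 
      have := ev 1
      simp [gk] at this ⊢
      rw [this]; ring
    | succ k ih =>
      have : Finset.Icc (-((k + 1 : ℕ) : ℤ)) ((k + 1 : ℕ) : ℤ) =
        insert (-((k + 1 : ℕ) : ℤ)) (insert ((k + 1 : ℕ) : ℤ) (Finset.Icc (-(k : ℤ)) k)) := by
        ext m; simp; omega
      rw [this, Finset.sum_insert (by simp; omega), Finset.sum_insert (by simp), ih]
      have e1 := ev (k + 1)
      have e2 := ev (k + 2)
      have e3 := ev k
      simp only [gk]
      push_cast
      have d1 : (-1 + -(k : ℤ)) = -(k+1) := by ring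
      rw [show (-((k : ℤ) + 1) - 1) = -(k + 2) by ring, show (-((k : ℤ) + 1) + 1) = -k by ring, e1, e2, e3,
       show ((k : ℤ) + 1 - 1) = k by ring, show ((k : ℤ) + 1 + 1) = k + 2 by ring]
      ring
  rw [tel]
  have hC : 0 < clam / lam / (1 - lam) := by
    have := hlam.1
    have : 0 < 1 - lam := by linarith [hlam.2]
    positivity
  have : Fp lam Δx N ≤ Fp lam Δx (N + 1) := by
    unfold Fp
    apply Real.rpow_le_rpow (abs_nonneg _) _ (by linarith [hlam.2])
    push_cast
    rw [abs_of_nonneg (by positivity), abs_of_nonneg (by positivity)]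
    nlinarith
  nlinarith

noncomputable def gp (clam lam Δx : ℝ) (n : ℤ) : ℝ := if n = 0 then 0 else gk clam lam Δx n

lemma gp_nonneg (clam lam : ℝ) (hclam : 0 < clam) (hlam : lam ∈ Set.Ioo (0 : ℝ) 1) (Δx : ℝ) (hΔx : 0 < Δx)
    (n : ℤ) : 0 ≤ gp clam lam Δx n := by
  unfold gp
  split_ifs with h
  · rfl
  · exact gk_nonneg clam lam hclam hlam Δx hΔx n h

lemma gp_sum_le (clam lam : ℝ) (hclam : 0 < clam) (hlam : lam ∈ Set.Ioo (0 : ℝ) 1) (Δx : ℝ) (hΔx : 0 < Δx)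
    (s : Finset ℤ) : ∑ n ∈ s, gp clam lam Δx n ≤ - gk clam lam Δx 0 := by
  obtain ⟨N, hN⟩ : ∃ N : ℕ, s ⊆ Finset.Icc (-(N : ℤ)) N := by
    refine ⟨∑ n ∈ s, n.natAbs, fun m hm => ?_⟩
    have := Finset.single_le_sum (f := fun n : ℤ => n.natAbs) (fun _ _ => Nat.zero_le _) hm
    simp only [Finset.mem_Icc]
    omega
  refine (Finset.sum_le_sum_of_subset_of_nonneg hN
    (fun n _ _ => gp_nonneg clam lam hclam hlam Δx hΔx n)).trans ?_
  have h := gk_sum clam lam hclam hlam Δx hΔx N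
  have h0 : (0 : ℤ) ∈ Finset.Icc (-(N : ℤ)) N := by simp
  rw [← Finset.add_sum_erase _ _ h0] at h ⊢
  have : ∑ x ∈ (Finset.Icc (-(N : ℤ)) N).erase 0, gp clam lam Δx x =
      ∑ x ∈ (Finset.Icc (-(N : ℤ)) N).erase 0, gk clam lam Δx x := by
    apply Finset.sum_congr rfl
    intro x hx
    simp [gp, (Finset.mem_erase.1 hx).1]
  rw [this]
  simp only [gp, if_true]
  linarith

lemma gp_summable (clam lam : ℝ) (hclam : 0 < clam) (hlam : lam ∈ Set.Ioo (0 : ℝ) 1) (Δx : ℝ) (hΔx : 0 < Δx) :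
    Summable (gp clam lam Δx) ∧ ∑' n, gp clam lam Δx n ≤ - gk clam lam Δx 0 := by
  have hs := summable_of_sum_le (gp_nonneg clam lam hclam hlam Δx hΔx) (gp_sum_le clam lam hclam hlam Δx hΔx)
  exact ⟨hs, hs.tsum_le_of_sum_le (gp_sum_le clam lam hclam hlam Δx hΔx)⟩
lemma slope_exists (g : ℝ → ℝ) (hm : Monotone g) (hd : Differentiable ℝ g) (M : ℝ)
    (hM : ∀ x, |deriv g x| ≤ M) (u v : ℝ) : ∃ p, 0 ≤ p ∧ p ≤ M ∧ g u - g v = p * (u - v) := by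
  have hM0 : 0 ≤ M := (abs_nonneg _).trans (hM 0)
  have key : ∀ x y, x ≤ y → g y - g x ≤ M * (y - x) :=
    fun x y h => image_sub_le_mul_sub_of_deriv_le hd (fun z => (le_abs_self _).trans (hM z)) h
  rcases lt_trichotomy u v with h | h | h
  · have h' : 0 < v - u := by linarith
    refine ⟨(g v - g u) / (v - u), div_nonneg (sub_nonneg.2 (hm h.le)) h'.le, ?_, ?_⟩
    · rw [div_le_iff₀ h']; exact key _ _ h.le
    · have := h'.ne'
      field_simp
      ring
  · exact ⟨0, le_rfl, hM0, by simp [h]⟩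
  · have h' : 0 < u - v := by linarith
    refine ⟨(g u - g v) / (u - v), div_nonneg (sub_nonneg.2 (hm h.le)) h'.le, ?_, ?_⟩
    · rw [div_le_iff₀ h']; exact key _ _ h.le
    · have := h'.ne'
      field_simp

lemma contraction_abs (D E c l r g : ℤ → ℝ) (κ : ℝ)
    (hE : ∀ i, E i = c i * D i + l i * D (i + 1) + r i * D (i - 1) + κ * ∑' j, g (j - i) * D j)
    (hc : ∀ i, 0 ≤ c i) (hl : ∀ i, 0 ≤ l i) (hr : ∀ i, 0 ≤ r i) (hg : ∀ i, 0 ≤ g i)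
    (hκ : 0 ≤ κ) (hgs : Summable g)
    (hcol : ∀ j, c j + l (j - 1) + r (j + 1) + κ * ∑' n, g n ≤ 1) :
    ∑' i, ‖E i‖ₑ ≤ ∑' i, ‖D i‖ₑ := by
  have pt : ∀ i, ‖E i‖ₑ ≤ ‖c i‖ₑ * ‖D i‖ₑ + ‖l i‖ₑ * ‖D (i + 1)‖ₑ + ‖r i‖ₑ * ‖D (i - 1)‖ₑ
      + ‖κ‖ₑ * ∑' j, ‖g (j - i)‖ₑ * ‖D j‖ₑ := by
    intro i
    rw [hE i]
    refine (enorm_add_le _ _).trans (add_le_add ((enorm_add_le _ _).trans (add_le_add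
      ((enorm_add_le _ _).trans (add_le_add (enorm_mul _ _).le (enorm_mul _ _).le))
      (enorm_mul _ _).le)) ?_)
    rw [enorm_mul]
    gcongr
    refine (enorm_tsum_le_tsum_enorm).trans ?_
    simp only [enorm_mul, le_refl]
  refine (ENNReal.tsum_le_tsum pt).trans ?_
  rw [ENNReal.tsum_add, ENNReal.tsum_add, ENNReal.tsum_add, ENNReal.tsum_mul_left,
    ENNReal.tsum_comm]
  have e1 : ∑' i, ‖l i‖ₑ * ‖D (i + 1)‖ₑ = ∑' i, ‖l (i - 1)‖ₑ * ‖D i‖ₑ := by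
    rw [← (Equiv.subRight (1 : ℤ)).tsum_eq (fun i => ‖l i‖ₑ * ‖D (i + 1)‖ₑ)]
    simp
  have e2 : ∑' i, ‖r i‖ₑ * ‖D (i - 1)‖ₑ = ∑' i, ‖r (i + 1)‖ₑ * ‖D i‖ₑ := by
    rw [← (Equiv.addRight (1 : ℤ)).tsum_eq (fun i => ‖r i‖ₑ * ‖D (i - 1)‖ₑ)]
    simp
  have e3 : ∀ j, ∑' i, ‖g (j - i)‖ₑ * ‖D j‖ₑ = (∑' n, ‖g n‖ₑ) * ‖D j‖ₑ := by
    intro j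
    rw [ENNReal.tsum_mul_right, ← (Equiv.subLeft j).tsum_eq (fun i => ‖g i‖ₑ)]
    simp
  rw [e1, e2, ← ENNReal.tsum_mul_left, ← ENNReal.tsum_add, ← ENNReal.tsum_add,
    ← ENNReal.tsum_add]
  apply ENNReal.tsum_le_tsum
  intro j
  rw [e3, ← mul_assoc, ← add_mul, ← add_mul, ← add_mul]
  have : ‖c j‖ₑ + ‖l (j - 1)‖ₑ + ‖r (j + 1)‖ₑ + ‖κ‖ₑ * ∑' n, ‖g n‖ₑ ≤ 1 := by
    have : ∑' n, ‖g n‖ₑ = ENNReal.ofReal (∑' n, g n) := by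
      rw [ENNReal.ofReal_tsum_of_nonneg hg hgs]
      congr 1; funext n; exact Real.enorm_of_nonneg (hg n)
    rw [this, Real.enorm_of_nonneg (hc _), Real.enorm_of_nonneg (hl _),
      Real.enorm_of_nonneg (hr _), Real.enorm_of_nonneg hκ, ← ENNReal.ofReal_mul hκ,
      ← ENNReal.ofReal_add (hc _) (hl _),
      ← ENNReal.ofReal_add (add_nonneg (hc _) (hl _)) (hr _),
      ← ENNReal.ofReal_add (add_nonneg (add_nonneg (hc _) (hl _)) (hr _))
        (mul_nonneg hκ (tsum_nonneg hg))]
    exact ENNReal.ofReal_le_one.2 (hcol j)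
  calc _ ≤ 1 * ‖D j‖ₑ := by gcongr
    _ = _ := one_mul _

lemma gp_mul_summable (clam lam : ℝ) (hclam : 0 < clam) (hlam : lam ∈ Set.Ioo (0 : ℝ) 1) (Δx : ℝ) (hΔx : 0 < Δx)
    (U : ℤ → ℝ) (hU : Summable U) (i : ℤ) : Summable (fun j => gp clam lam Δx (j - i) * U j) := by
  refine Summable.of_norm_bounded (g := fun j => (- gk clam lam Δx 0) * |U j|)
    (hU.abs.mul_left _) ?_
  intro j
  have h1 := gp_sum_le clam lam hclam hlam Δx hΔx {j - i}
  rw [Finset.sum_singleton] at h1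
  rw [norm_mul, Real.norm_of_nonneg (gp_nonneg clam lam hclam hlam Δx hΔx _)]
  exact mul_le_mul_of_nonneg_right h1 (abs_nonneg _)

lemma gk_eq_single (clam lam Δx : ℝ) (n : ℤ) :
    gk clam lam Δx n = (if n = 0 then gk clam lam Δx 0 else 0) + gp clam lam Δx n := by
  unfold gp
  split_ifs with h <;> simp [h]

lemma tsum_Gw (clam lam : ℝ) (hclam : 0 < clam) (hlam : lam ∈ Set.Ioo (0 : ℝ) 1) (Δx : ℝ) (hΔx : 0 < Δx)
    (U : ℤ → ℝ) (hU : Summable U) (i : ℤ) : ∑' j, Gw clam lam Δx i j * U j =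
      gk clam lam Δx 0 * U i + ∑' j, gp clam lam Δx (j - i) * U j := by
  have h1 : HasSum (fun j => if j = i then gk clam lam Δx 0 * U i else 0) (gk clam lam Δx 0 * U i) :=
    hasSum_ite_eq i _
  rw [← h1.tsum_eq, ← h1.summable.tsum_add (gp_mul_summable clam lam hclam hlam Δx hΔx U hU i)]
  congr 1
  funext j
  rw [Gw_eq clam lam hlam Δx hΔx, gk_eq_single]
  simp only [sub_eq_zero]
  split_ifs with h
  · subst h; ring
  · ring

lemma Gw_prod_summable (clam lam : ℝ) (hclam : 0 < clam) (hlam : lam ∈ Set.Ioo (0 : ℝ) 1) (Δx : ℝ) (hΔx : 0 < Δx)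
    (U : ℤ → ℝ) (hU : Summable U) : Summable (fun p : ℤ × ℤ => Gw clam lam Δx p.1 p.2 * U p.2) := by
  have hgk : Summable (gk clam lam Δx) := by
    have h1 : HasSum (fun j : ℤ => if j = 0 then gk clam lam Δx 0 else 0) (gk clam lam Δx 0) :=
      hasSum_ite_eq 0 _
    refine (h1.summable.add (gp_summable clam lam hclam hlam Δx hΔx).1).congr ?_
    intro n
    exact (gk_eq_single clam lam Δx n).symm
  have h2 : Summable (fun p : ℤ × ℤ => gk clam lam Δx p.1 * U p.2) :=
    summable_mul_of_summable_norm hgk.norm hU.norm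
  have h3 := h2.comp_injective (i := fun p : ℤ × ℤ => (p.2 - p.1, p.2)) (by
    rintro ⟨a, b⟩ ⟨c, d⟩ h
    simp only [Prod.mk.injEq] at h ⊢
    omega)
  refine h3.congr ?_
  intro p
  simp [Gw_eq clam lam hlam Δx hΔx]

lemma Wq_diff (clam lam : ℝ) (hclam : 0 < clam) (hlam : lam ∈ Set.Ioo (0 : ℝ) 1) (Δx : ℝ) (hΔx : 0 < Δx)
    (Δt b : ℝ) (fhat : ℝ → ℝ → ℝ) (a : ℝ → ℝ)
    (U : ℤ → ℝ) (hU : Summable U) (i : ℤ) :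
    schemeStep clam lam Δx Δt b fhat a U (i + 1) - U (i + 1) =
     -(Δt / Δx) * (Wq clam lam Δx b fhat a U (i + 1) - Wq clam lam Δx b fhat a U i) := by
  have hs := Gw_prod_summable clam lam hclam hlam Δx hΔx U hU
  set h : ℤ → ℝ := fun k => ∑' j, Gw clam lam Δx k j * U j with hh
  have hsum : Summable h := hs.prod
  have e : ∀ i : ℤ, ∑' p : {k : ℤ // k ≤ i} × ℤ, Gw clam lam Δx p.1.val p.2 * U p.2 =
      ∑' k, (Set.Iic i).indicator h k := by
    intro i
    have h1 : Summable (fun p : {k : ℤ // k ≤ i} × ℤ => Gw clam lam Δx p.1.val p.2 * U p.2) :=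
      hs.comp_injective (i := fun p : {k : ℤ // k ≤ i} × ℤ => (p.1.val, p.2)) (by
        rintro ⟨a, b⟩ ⟨c, d⟩ h
        simp only [Prod.mk.injEq] at h ⊢
        exact ⟨Subtype.ext h.1, h.2⟩)
    rw [h1.tsum_prod]
    exact tsum_subtype (Set.Iic i) h
  have e2 : ∑' k, (Set.Iic (i + 1)).indicator h k - ∑' k, (Set.Iic i).indicator h k = h (i + 1) := by
    rw [← (hsum.indicator _).tsum_sub (hsum.indicator _), tsum_eq_single (i + 1)]
    · simp [Set.indicator]
    · intro k hk
      have : k ≤ i + 1 ↔ k ≤ i := by omega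
      simp [Set.indicator, this]
  unfold Wq schemeStep
  rw [e, e]
  have e3 : ∑' k, (Set.Iic (i + 1)).indicator h k = ∑' k, (Set.Iic i).indicator h k + h (i + 1) := by
    linarith
  rw [e3]
  have e4 : ∑' j, Gw clam lam Δx (i + 1) j * U j = h (i + 1) := rfl
  rw [e4, add_sub_cancel_right]
  have := hΔx.ne'
  field_simp
  ring

lemma Aint_slope (f a : ℝ → ℝ) (fhat : ℝ → ℝ → ℝ) (hdata : SchemeData f a fhat) (Ma : ℝ)
    (hMa : ∀ s, |a s| ≤ Ma) (u v : ℝ) :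
    ∃ p, 0 ≤ p ∧ p ≤ Ma ∧ Aint a u - Aint a v = p * (u - v) := by
  obtain ⟨K, hK⟩ := hdata.haLip
  have hd : ∀ x, HasDerivAt (Aint a) (a x) x := fun x =>
    intervalIntegral.integral_hasDerivAt_right (hK.continuous.intervalIntegrable _ _)
      (hK.continuous.stronglyMeasurableAtFilter _ _) hK.continuous.continuousAt
  have hdd : Differentiable ℝ (Aint a) := fun x => (hd x).differentiableAt
  refine slope_exists (Aint a) (monotone_of_deriv_nonneg hdd ?_) hdd Ma ?_ u v
  · intro x; rw [(hd x).deriv]; exact hdata.haNonneg x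
  · intro x; rw [(hd x).deriv]; exact hMa x

lemma scheme_contraction (lam : ℝ) (hlam : lam ∈ Set.Ioo (0 : ℝ) 1)
    (clam : ℝ) (hclam : 0 < clam) (Δx Δt : ℝ) (hΔx : 0 < Δx) (hΔt : 0 < Δt)
    (b : ℝ) (hb : 0 ≤ b) (f a : ℝ → ℝ) (fhat : ℝ → ℝ → ℝ)
    (hdata : SchemeData f a fhat)
    (hcfl : CFL clam lam Δx Δt b fhat a) (U V : ℤ → ℝ) (hU : Summable U) (hV : Summable V) :
    ∑' i, ‖schemeStep clam lam Δx Δt b fhat a U i - schemeStep clam lam Δx Δt b fhat a V i‖ₑ ≤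
      ∑' i, ‖U i - V i‖ₑ := by
  obtain ⟨hC1, M1, M2, Ma, hM1, hM2, hMa, hle⟩ := hcfl
  have hdiff := hC1.differentiable one_ne_zero
  have hp : ∀ i, ∃ p, 0 ≤ p ∧ p ≤ M1 ∧
      fhat (U i) (U (i + 1)) - fhat (V i) (U (i + 1)) = p * (U i - V i) := by
    intro i
    refine slope_exists (fun s => fhat s (U (i + 1))) (hdata.hmono1 _) ?_ M1 (fun x => hM1 x _) _ _
    exact hdiff.comp (differentiable_id.prodMk (differentiable_const (U (i + 1))))
  have hq : ∀ i, ∃ p, 0 ≤ p ∧ p ≤ M2 ∧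
      -fhat (V i) (U (i + 1)) - -fhat (V i) (V (i + 1)) = p * (U (i + 1) - V (i + 1)) := by
    intro i
    refine slope_exists (fun s => -fhat (V i) s) (hdata.hmono2 _).neg ?_ M2 (fun x => ?_) _ _
    · exact (hdiff.comp ((differentiable_const (V i)).prodMk differentiable_id)).neg
    · rw [deriv.fun_neg, abs_neg]; exact hM2 _ _
  have hra := fun i => Aint_slope f a fhat hdata Ma hMa (U i) (V i)
  choose p hp0 hpM hpe using hp
  choose q hq0 hqM hqe using hq
  choose r hr0 hrM hre using hra
  set μ := Δt / Δx with hμ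
  set ν := Δt / Δx ^ 2 with hν
  set κ := b * Δt / Δx with hκ
  have hμ0 : 0 ≤ μ := by positivity
  have hν0 : 0 ≤ ν := by positivity
  have hκ0 : 0 ≤ κ := by positivity
  have hκg : κ * gk clam lam Δx 0 = - (b * dlam clam lam * Δt / Δx ^ lam) := by
    rw [gk_zero clam lam hlam Δx hΔx, hκ]
    have := hΔx.ne'
    field_simp
  have hν2 : 2 * Δt / Δx ^ 2 = 2 * ν := by rw [hν]; ring
  rw [hν2] at hle
  obtain ⟨gs, gle⟩ := gp_summable clam lam hclam hlam Δx hΔx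
  refine contraction_abs (fun i => U i - V i) _
    (fun i => 1 - μ * (p i + q (i - 1)) - 2 * ν * r i + κ * gk clam lam Δx 0)
    (fun i => μ * q i + ν * r (i + 1)) (fun i => μ * p (i - 1) + ν * r (i - 1))
    (gp clam lam Δx) κ ?_ ?_ ?_ ?_ (gp_nonneg clam lam hclam hlam Δx hΔx) hκ0 gs ?_
  · intro i
    have sU := gp_mul_summable clam lam hclam hlam Δx hΔx U hU i
    have sV := gp_mul_summable clam lam hclam hlam Δx hΔx V hV i
    have e : ∑' j, gp clam lam Δx (j - i) * (U j - V j) =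
      ∑' j, gp clam lam Δx (j - i) * U j - ∑' j, gp clam lam Δx (j - i) * V j := by
      rw [← sU.tsum_sub sV]; simp only [mul_sub]
    simp only [schemeStep]
    rw [e, tsum_Gw clam lam hclam hlam Δx hΔx U hU, tsum_Gw clam lam hclam hlam Δx hΔx V hV]
    have a1 := hpe i
    have a2 := hpe (i - 1)
    have b1 := hqe i
    have b2 := hqe (i - 1)
    have c1 := hre i
    have c2 := hre (i - 1)
    have c3 := hre (i + 1)
    rw [sub_add_cancel] at a2 b2
    linear_combination (-μ) * a1 + μ * a2 + μ * b1 - μ * b2 + ν * c2 + ν * c3 - 2 * ν * c1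
  · intro i
    have : μ * (p i + q (i - 1)) ≤ μ * (M1 + M2) :=
      mul_le_mul_of_nonneg_left (add_le_add (hpM _) (hqM _)) hμ0
    have : 2 * ν * r i ≤ 2 * ν * Ma := mul_le_mul_of_nonneg_left (hrM _) (by positivity)
    linarith
  · intro i
    have := hq0 i
    have := hr0 (i + 1)
    positivity
  · intro i
    have := hp0 (i - 1)
    have := hr0 (i - 1)
    positivity
  · intro j
    simp only [sub_add_cancel, add_sub_cancel_right]
    have := mul_le_mul_of_nonneg_left gle hκ0
    linarith

lemma U0_summable (Δx : ℝ) (hΔx : 0 < Δx) (u₀ : ℝ → ℝ) (hu₀1 : Integrable u₀) :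
    Summable (fun i : ℤ => (1 / Δx) * ∫ x in Set.Ioo ((i : ℝ) * Δx) (((i : ℝ) + 1) * Δx), u₀ x) := by
  apply Summable.mul_left
  refine (hasSum_integral_iUnion (f := u₀) (μ := volume)
    (s := fun i : ℤ => Set.Ioo ((i : ℝ) * Δx) (((i : ℝ) + 1) * Δx))
    (fun i => measurableSet_Ioo) ?_ hu₀1.integrableOn).summable
  intro i j hij
  rw [Function.onFun, Set.disjoint_left]
  rintro x ⟨h1, h2⟩ ⟨h3, h4⟩
  have e1 : (i : ℝ) < j + 1 := lt_of_mul_lt_mul_right (h1.trans h4) hΔx.le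
  have e2 : (j : ℝ) < i + 1 := lt_of_mul_lt_mul_right (h3.trans h2) hΔx.le
  have e1' : i < j + 1 := by exact_mod_cast e1
  have e2' : j < i + 1 := by exact_mod_cast e2
  omega

/-- `L¹`-Lipschitz continuity in time of the scheme iterates:
`Σ_i |U_i^m − U_i^n| ≤ (Σ_i |W_{i+1}^0 − W_i^0|)(Δt/Δx)|m − n|`. -/
theorem scheme_L1_time_Lipschitz (lam : ℝ) (hlam : lam ∈ Set.Ioo (0 : ℝ) 1)
    (clam : ℝ) (hclam : 0 < clam) (Δx Δt : ℝ) (hΔx : 0 < Δx) (hΔt : 0 < Δt)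
    (b : ℝ) (hb : 0 ≤ b) (f a : ℝ → ℝ) (fhat : ℝ → ℝ → ℝ)
    (hdata : SchemeData f a fhat) (hfC1 : ContDiff ℝ 1 f)
    (u₀ : ℝ → ℝ) (hu₀1 : Integrable u₀) (hu₀bv : eVariationOn u₀ Set.univ ≠ ⊤)
    (hcfl : CFL clam lam Δx Δt b fhat a) :
    ∀ m n : ℕ,
      ∑' i : ℤ, (‖Uiter clam lam Δx Δt b fhat a u₀ m i -
          Uiter clam lam Δx Δt b fhat a u₀ n i‖₊ : ENNReal) ≤
      (∑' i : ℤ, (‖Wq clam lam Δx b fhat a (Uiter clam lam Δx Δt b fhat a u₀ 0) (i + 1) -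
          Wq clam lam Δx b fhat a (Uiter clam lam Δx Δt b fhat a u₀ 0) i‖₊ : ENNReal)) *
        ENNReal.ofReal (Δt / Δx) * (Nat.dist m n : ENNReal) := by
  set U := Uiter clam lam Δx Δt b fhat a u₀ with hUdef
  have hS : ∀ n, U (n + 1) = schemeStep clam lam Δx Δt b fhat a (U n) := fun n => rfl
  have hcontr := scheme_contraction lam hlam clam hclam Δx Δt hΔx hΔt b hb f a fhat hdata hcfl
  have hsum : ∀ n, Summable (U n) := by
    intro n
    induction n with
    | zero => exact U0_summable Δx hΔx u₀ hu₀1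
    | succ k ih =>
      have h := hcontr (U k) (fun _ => 0) ih summable_zero
      have hz : ∀ i, schemeStep clam lam Δx Δt b fhat a (fun _ => 0) i = 0 := by
        intro i; simp [schemeStep]; right; ring
      simp only [hz, sub_zero, ← hS] at h
      apply Summable.of_enorm
      refine ne_top_of_le_ne_top ?_ h
      simp only [enorm_eq_nnnorm]
      exact ENNReal.tsum_coe_ne_top_iff_summable.2 (NNReal.summable_coe.1 ih.norm)
  set R := (∑' i : ℤ, (‖Wq clam lam Δx b fhat a (U 0) (i + 1) -
          Wq clam lam Δx b fhat a (U 0) i‖₊ : ENNReal)) * ENNReal.ofReal (Δt / Δx) with hR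
  have h01 : ∑' i, ‖U 1 i - U 0 i‖ₑ = R := by
    rw [hR, ← ENNReal.tsum_mul_right, ← (Equiv.addRight (1 : ℤ)).tsum_eq]
    congr 1
    funext i
    have := Wq_diff clam lam hclam hlam Δx hΔx Δt b fhat a (U 0) (hsum 0) i
    simp only [Equiv.coe_addRight]
    rw [show U 1 = schemeStep clam lam Δx Δt b fhat a (U 0) from rfl, this, enorm_mul, enorm_neg,
      Real.enorm_of_nonneg (div_pos hΔt hΔx).le, mul_comm]
    rfl
  have hstep : ∀ n, ∑' i, ‖U (n + 1) i - U n i‖ₑ ≤ R := by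
    intro n
    induction n with
    | zero => exact h01.le
    | succ k ih => exact (hcontr (U (k + 1)) (U k) (hsum _) (hsum _)).trans ih
  have hk : ∀ n k, ∑' i, ‖U (n + k) i - U n i‖ₑ ≤ R * (k : ENNReal) := by
    intro n k
    induction k with
    | zero => simp
    | succ k ih =>
      calc ∑' i, ‖U (n + (k + 1)) i - U n i‖ₑ
          ≤ ∑' i, (‖U (n + k + 1) i - U (n + k) i‖ₑ + ‖U (n + k) i - U n i‖ₑ) := by
            apply ENNReal.tsum_le_tsum
            intro i
            rw [← sub_add_sub_cancel (U (n + (k + 1)) i) (U (n + k) i) (U n i)]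
            exact enorm_add_le _ _
        _ ≤ R + R * (k : ENNReal) := by
            rw [ENNReal.tsum_add]
            exact add_le_add (hstep _) ih
        _ = _ := by push_cast; ring
  intro m n
  rcases le_total n m with h | h
  · obtain ⟨k, rfl⟩ := Nat.exists_eq_add_of_le h
    have : Nat.dist (n + k) n = k := by rw [Nat.dist_eq_sub_of_le_right h]; omega
    rw [this]
    exact hk n k
  · obtain ⟨k, rfl⟩ := Nat.exists_eq_add_of_le h
    have : Nat.dist m (m + k) = k := by rw [Nat.dist_eq_sub_of_le h]; omega
    rw [this]
    refine le_trans (le_of_eq ?_) (hk m k)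
    congr 1
    funext i
    rw [← enorm_neg, neg_sub]
    rfl
end
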